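/- Let q be an odd prime power. For every j ∈ {1,…,q}\{(q+1)/2} and every k ∈ {1,…,q−2}\{(q−1)/2}, the set S_j ∪ E_k is a quasi-Hermitian surface of PG(3,q²): it has exactly (q²+1)(q³+1) points, and every plane of PG(3,q²) meets it in either q³+1 or q³+q²+1 points. -/

import Mathlib

noncomputable section

open Matrix

/-- The points of `PG(3,q²)`: the projectivization of `F⁴` where `F = 𝔽_{q²}`. -/
abbrev PGPoint (F : Type*) [Field F] := Projectivization F (Fin 4 → F)

/-- The form `F_γ(X₁,X₂,X₃,X₄) = X₁^q X₄ + X₁ X₄^q − X₂^{q+1} − X₃^{q+1}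
    − γ (X₁X₄ − X₂X₃)^{(q+1)/2}`. -/
def Fgam {F : Type*} [Field F] (q : ℕ) (γ : F) (x : Fin 4 → F) : F :=
  x 0 ^ q * x 3 + x 0 * x 3 ^ q - x 1 ^ (q + 1) - x 2 ^ (q + 1)
    - γ * (x 0 * x 3 - x 1 * x 2) ^ ((q + 1) / 2)

/-- The point set `C_γ` of `PG(3,q²)`, the zero locus of `F_γ`. -/
def Cgam {F : Type*} [Field F] (q : ℕ) (γ : F) : Set (PGPoint F) :=
  {P | ∀ (v : Fin 4 → F) (hv : v ≠ 0), P = Projectivization.mk F v hv → Fgam q γ v = 0}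

/-- Kronecker product of two 2×2 matrices, as a 4×4 matrix. -/
def kron {F : Type*} [Field F] (A B : Matrix (Fin 2) (Fin 2) F) :
    Matrix (Fin 4) (Fin 4) F :=
  Matrix.of fun i j =>
    A ⟨i.val / 2, by have := i.isLt; omega⟩ ⟨j.val / 2, by have := j.isLt; omega⟩ *
    B ⟨i.val % 2, by have := i.isLt; omega⟩ ⟨j.val % 2, by have := j.isLt; omega⟩

/-- Entrywise `q`-th power (the matrix `A^q`). -/
def matq {F : Type*} [Field F] (q : ℕ) (A : Matrix (Fin 2) (Fin 2) F) :
    Matrix (Fin 2) (Fin 2) F :=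
  A.map (· ^ q)

/-- The orbit of a point of `PG(3,q²)` under the group `K ≅ PSL(2,q²)` of projectivities
    induced by the matrices `A^q ⊗ A` with `A ∈ SL(2,𝔽_{q²})`. -/
def Korb {F : Type*} [Field F] (q : ℕ) (P : PGPoint F) : Set (PGPoint F) :=
  {P' | ∃ A : Matrix (Fin 2) (Fin 2) F, A.det = 1 ∧
    ∃ (v : Fin 4 → F) (hv : v ≠ 0) (hw : Matrix.vecMul v (kron (matq q A) A) ≠ 0),
      P = Projectivization.mk F v hv ∧ P' = Projectivization.mk F _ hw}

/-- The orbit of a point of `PG(3,q²)` under the group `G ≅ PGL(2,q²)` of projectivities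
    induced by the matrices `A^q ⊗ A` with `A ∈ GL(2,𝔽_{q²})`. -/
def Gorb {F : Type*} [Field F] (q : ℕ) (P : PGPoint F) : Set (PGPoint F) :=
  {P' | ∃ A : Matrix (Fin 2) (Fin 2) F, A.det ≠ 0 ∧
    ∃ (v : Fin 4 → F) (hv : v ≠ 0) (hw : Matrix.vecMul v (kron (matq q A) A) ≠ 0),
      P = Projectivization.mk F v hv ∧ P' = Projectivization.mk F _ hw}

/-- The Hermitian Veronese curve `O = {(1,t,t^q,t^{q+1})} ∪ {(0,0,0,1)}`. -/
def Oset (F : Type*) [Field F] (q : ℕ) : Set (PGPoint F) :=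
  {P | (∃ (t : F) (hv : ![1, t, t ^ q, t ^ (q + 1)] ≠ 0),
        P = Projectivization.mk F _ hv) ∨
    ∃ (hv : (![0, 0, 0, 1] : Fin 4 → F) ≠ 0), P = Projectivization.mk F _ hv}

/-- The Baer subgeometry `Σ = {(a,b,b^q,c) : a,c ∈ 𝔽_q, b ∈ 𝔽_{q²}}`. -/
def SigmaSet (F : Type*) [Field F] (q : ℕ) : Set (PGPoint F) :=
  {P | ∃ (a b c : F) (hv : ![a, b, b ^ q, c] ≠ 0),
    a ^ q = a ∧ c ^ q = c ∧ P = Projectivization.mk F _ hv}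

/-- The hyperbolic quadric `Q⁺(3,q²) : X₁X₄ − X₂X₃ = 0`. -/
def Qplus (F : Type*) [Field F] : Set (PGPoint F) :=
  {P | ∀ (v : Fin 4 → F) (hv : v ≠ 0), P = Projectivization.mk F v hv →
    v 0 * v 3 - v 1 * v 2 = 0}

/-- A line of `PG(3,q²)`: the set of points lying in a 2-dimensional subspace. -/
def IsLine {F : Type*} [Field F] (ℓ : Set (PGPoint F)) : Prop :=
  ∃ W : Submodule F (Fin 4 → F), Module.finrank F W = 2 ∧ ℓ = {P | P.rep ∈ W}

/-- A plane of `PG(3,q²)`: the set of points lying in a 3-dimensional subspace. -/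
def IsPlane {F : Type*} [Field F] (π : Set (PGPoint F)) : Prop :=
  ∃ W : Submodule F (Fin 4 → F), Module.finrank F W = 3 ∧ π = {P | P.rep ∈ W}

section QuasiHermitian

open Finset

theorem card_filter_pow_eq {F : Type*} [Field F] [Fintype F] [DecidableEq F] {m l : ℕ}
    (hml : m * l = Fintype.card F - 1) {e : F} (he : e ^ l = 1) :
    #{x : F | x ^ m = e} = m := by
  have hpos : 0 < m * l := by
    have := Fintype.one_lt_card (α := F); omega
  have hm : 0 < m := Nat.pos_of_mul_pos_right hpos
  have hl : 0 < l := Nat.pos_of_mul_pos_left hpos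
  have he0 : e ≠ 0 := by
    rintro rfl
    rw [zero_pow hl.ne'] at he
    exact zero_ne_one he
  obtain ⟨g, hg⟩ := IsCyclic.exists_generator (α := Fˣ)
  have hord : orderOf g = m * l := by
    rw [orderOf_eq_card_of_forall_mem_zpowers hg, Nat.card_eq_fintype_card, Fintype.card_units, hml]
  have hgp : IsPrimitiveRoot (g : F) (m * l) := by
    rw [← hord, ← orderOf_units]
    exact IsPrimitiveRoot.orderOf _
  have hζ : IsPrimitiveRoot ((g : F) ^ l) m := hgp.pow hpos (mul_comm _ _)
  have hex : ∃ x : F, x ^ m = e := by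
    obtain ⟨i, hi⟩ := (mem_powers_iff_mem_zpowers (x := g) (y := Units.mk0 e he0)).2 (hg _)
    have hi' : (g : F) ^ i = e := by
      have := congrArg Units.val hi
      simpa using this
    have : m * l ∣ i * l := by
      apply hgp.dvd_of_pow_eq_one
      rw [pow_mul, hi', he]
    obtain ⟨k, rfl⟩ := Nat.dvd_of_mul_dvd_mul_right hl this
    exact ⟨(g : F) ^ k, by rw [← pow_mul, mul_comm, hi']⟩
  have hcard := hζ.card_nthRoots e
  rw [if_pos hex] at hcard
  have hnd := hζ.nthRoots_nodup he0
  calc #{x : F | x ^ m = e} = #(Polynomial.nthRoots m e).toFinset := by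
        congr 1
        ext x
        simp [Polynomial.mem_nthRoots hm]
    _ = m := by rw [Multiset.toFinset_card_of_nodup hnd, hcard]

/-- `F` has `(2m+1)²` elements and `σ` is its involution `x ↦ x^(2m+1)`. -/
structure IsQuadExt {F : Type*} [Field F] [Fintype F] (σ : F →+* F) (m : ℕ) : Prop where
  card : Fintype.card F = (2 * m + 1) ^ 2
  pos : 0 < m
  apply : ∀ x, σ x = x ^ (2 * m + 1)

namespace IsQuadExt

variable {F : Type*} [Field F] [Fintype F] {σ : F →+* F} {m : ℕ} (h : IsQuadExt σ m)
include h

theorem card_sub_one : Fintype.card F - 1 = 4 * m * (m + 1) := by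
  rw [h.card, show (2 * m + 1) ^ 2 = 4 * m * (m + 1) + 1 by ring, Nat.add_sub_cancel]

theorem conj_conj (x : F) : σ (σ x) = x := by
  rw [h.apply, h.apply, ← pow_mul, ← sq, ← h.card, FiniteField.pow_card]

theorem two_ne_zero : (2 : F) ≠ 0 := by
  intro h2
  have hc : ringChar F = 2 := by
    apply CharP.ringChar_of_prime_eq_zero Nat.prime_two
    exact_mod_cast h2
  have := (FiniteField.even_card_iff_char_two (F := F)).1 hc
  rw [h.card, Nat.pow_mod] at this
  simp [Nat.add_mod] at this

theorem pow_half_mul_self (x : F) : x ^ (m + 1) * x ^ (m + 1) = x * σ x := by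
  rw [h.apply]; ring

theorem conj_pow_half (x : F) : σ (x ^ (m + 1)) = x ^ (m + 1) * x ^ (2 * m * (m + 1)) := by
  rw [map_pow, h.apply]; ring

theorem card_mul_conj_eq [DecidableEq F] {t : F} (ht : σ t = t) :
    #{x : F | x * σ x = t} = if t = 0 then 1 else 2 * m + 2 := by
  split_ifs with h0
  · subst h0
    simp [Finset.filter_eq']
  · have h1 : ∀ x : F, x * σ x = x ^ (2 * m + 2) := fun x => by rw [h.apply]; ring
    simp only [h1]
    apply card_filter_pow_eq (l := 2 * m)
    · rw [h.card_sub_one]; ring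
    · rw [h.apply, pow_succ] at ht
      exact mul_right_cancel₀ h0 (by rw [ht, one_mul])

theorem conj_eq_iff {γ ε d : F} (hγ : γ ≠ 0) (hε : ε * ε = 1) (hγε : σ γ = ε * γ) (hd : d ≠ 0) :
    σ (γ * d ^ (m + 1)) = γ * d ^ (m + 1) ↔ d ^ (2 * m * (m + 1)) = ε := by
  rw [map_mul, h.conj_pow_half, hγε]
  have h1 : γ * d ^ (m + 1) ≠ 0 := mul_ne_zero hγ (pow_ne_zero _ hd)
  constructor
  · intro h2
    have h3 : ε * d ^ (2 * m * (m + 1)) = 1 := by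
      apply mul_left_cancel₀ h1
      linear_combination h2
    linear_combination ε * h3 - d ^ (2 * m * (m + 1)) * hε
  · intro h2
    rw [h2]
    linear_combination γ * d ^ (m + 1) * hε

theorem card_affine [DecidableEq F] {γ ε : F} (hγ : γ ≠ 0) (hε : ε * ε = 1) (hγε : σ γ = ε * γ) :
    #{p : F × F | p.1 ≠ 0 ∧ p.1 + σ p.1 - p.2 * σ p.2 = γ * p.1 ^ (m + 1)} +
      (2 * m + 1) * #{d : F | d ^ (2 * m * (m + 1)) = ε ∧ d + σ d - γ * d ^ (m + 1) = 0} =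
      2 * m * (m + 1) * (2 * m + 2) := by
  have hm := h.pos
  have he : 2 * m * (m + 1) ≠ 0 := by positivity
  have hε0 : ε ≠ 0 := by rintro rfl; simp at hε
  have h1 : ∀ d : F, #{w : F | d ≠ 0 ∧ d + σ d - w * σ w = γ * d ^ (m + 1)} +
      (2 * m + 1) * (if d ^ (2 * m * (m + 1)) = ε ∧ d + σ d - γ * d ^ (m + 1) = 0 then 1 else 0)
      = if d ^ (2 * m * (m + 1)) = ε then 2 * m + 2 else 0 := by
    intro d
    by_cases hd : d = 0
    · subst hd
      rw [zero_pow he]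
      simp [hε0.symm]
    by_cases hdε : d ^ (2 * m * (m + 1)) = ε
    · have h2 := (h.conj_eq_iff hγ hε hγε hd).2 hdε
      have h3 : σ (d + σ d - γ * d ^ (m + 1)) = d + σ d - γ * d ^ (m + 1) := by
        rw [map_sub, h2, map_add, h.conj_conj, add_comm (σ d)]
      have h4 := h.card_mul_conj_eq h3
      have h5 : ∀ w : F, (d ≠ 0 ∧ d + σ d - w * σ w = γ * d ^ (m + 1)) ↔
          w * σ w = d + σ d - γ * d ^ (m + 1) := by
        intro w
        constructor
        · rintro ⟨-, h6⟩; linear_combination -h6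
        · intro h6; exact ⟨hd, by linear_combination -h6⟩
      simp only [h5, h4, hdε, true_and, if_true]
      split_ifs <;> ring
    · have h5 : ∀ w : F, ¬ (d ≠ 0 ∧ d + σ d - w * σ w = γ * d ^ (m + 1)) := by
        rintro w ⟨-, h6⟩
        apply hdε
        rw [← h.conj_eq_iff hγ hε hγε hd, ← h6]
        simp only [map_sub, map_add, map_mul, h.conj_conj]
        ring
      simp [h5, hdε]
  have h2 : #{d : F | d ^ (2 * m * (m + 1)) = ε} = 2 * m * (m + 1) := by
    apply card_filter_pow_eq (l := 2)
    · rw [h.card_sub_one]; ring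
    · rw [sq, hε]
  have h3 := Finset.sum_congr (rfl : (univ : Finset F) = univ) (fun d _ => h1 d)
  rw [Finset.sum_add_distrib, ← Finset.mul_sum, ← Finset.card_filter] at h3
  rw [← Finset.sum_filter, Finset.sum_const, h2, smul_eq_mul] at h3
  rw [← h3]
  congr 1
  simp only [Finset.card_filter]
  rw [Fintype.sum_prod_type]

end IsQuadExt

/-- `γ = c + c⁻¹` with `c` not a fourth root of unity. -/
structure IsTraceParam {F : Type*} [Field F] (c γ ε : F) : Prop where
  ne_zero : c ≠ 0
  pow_four_ne : c ^ 4 ≠ 1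
  eq : γ = c + c⁻¹
  sign : ε * ε = 1

namespace IsTraceParam

variable {F : Type*} [Field F] {c γ ε : F} (hc : IsTraceParam c γ ε)
include hc

theorem sq_ne_one : c ^ 2 ≠ 1 := fun h2 => hc.pow_four_ne (by linear_combination (c ^ 2 + 1) * h2)

theorem mul_eq : γ * c = c ^ 2 + 1 := by
  rw [hc.eq]
  field_simp [hc.ne_zero]

theorem trace_ne_zero : γ ≠ 0 := by
  intro h0
  have := hc.mul_eq
  rw [h0] at this
  exact hc.pow_four_ne (by linear_combination (1 - c ^ 2) * this)

theorem trace_sq_ne_four : γ ^ 2 ≠ 4 := by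
  intro h0
  have h1 := hc.mul_eq
  have h2 : (c ^ 2 - 1) ^ 2 = 0 := by
    linear_combination c ^ 2 * h0 - (γ * c + c ^ 2 + 1) * h1
  exact hc.sq_ne_one (sub_eq_zero.1 (pow_eq_zero_iff (by norm_num) |>.1 h2))

theorem sign_ne_zero : ε ≠ 0 := by
  rintro rfl
  simpa using hc.sign

theorem conj_trace_of_circle {σ : F →+* F} (hS : c * σ c = ε) : σ γ = ε * γ := by
  have h0 := hc.ne_zero
  have h1 : σ c ≠ 0 := by simpa using h0
  rw [hc.eq, map_add, map_inv₀]
  field_simp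
  linear_combination (σ c - ε * c) * hS - c * hc.sign

theorem conj_trace_of_line {σ : F →+* F} (hE : σ c = ε * c) : σ γ = ε * γ := by
  have h0 := hc.ne_zero
  have h1 := hc.sign_ne_zero
  rw [hc.eq, map_add, map_inv₀, hE]
  field_simp
  linear_combination -hc.sign

theorem sub_mul_pow_eq {σ : F →+* F} {m : ℕ} (hσ : ∀ x, σ x = x ^ (2 * m + 1)) (d : F) :
    d + σ d - γ * d ^ (m + 1) = d * ((1 - d ^ m * c) * (1 - d ^ m * c⁻¹)) := by
  have h0 := hc.ne_zero
  rw [hσ, hc.eq]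
  field_simp
  ring

variable [Fintype F] [DecidableEq F] {σ : F →+* F} {m : ℕ} (h : IsQuadExt σ m)
include h

theorem card_zeros_of_circle (hS : c * σ c = ε) :
    #{d : F | d ^ (2 * m * (m + 1)) = ε ∧ d + σ d - γ * d ^ (m + 1) = 0} = 2 * m := by
  have h0 := hc.ne_zero
  have hm := h.pos
  have hS' : c ^ (2 * m + 2) = ε := by rw [← hS, h.apply]; ring
  have h4 : c ^ (4 * (m + 1)) = 1 := by
    rw [show 4 * (m + 1) = (2 * m + 2) * 2 by ring, pow_mul, hS', sq, hc.sign]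
  have hε : ε⁻¹ = ε := inv_eq_of_mul_eq_one_left hc.sign
  have h1 : univ.filter (fun d : F => d ^ (2 * m * (m + 1)) = ε ∧ d + σ d - γ * d ^ (m + 1) = 0) =
      univ.filter (fun d : F => d ^ m = c) ∪ univ.filter (fun d : F => d ^ m = c⁻¹) := by
    ext d
    simp only [mem_filter, mem_univ, true_and, mem_union, hc.sub_mul_pow_eq h.apply]
    have h2 : d ^ (2 * m * (m + 1)) = (d ^ m) ^ (2 * m + 2) := by rw [← pow_mul]; ring
    constructor
    · rintro ⟨h3, h5⟩
      rcases mul_eq_zero.1 h5 with h5 | h5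
      · subst h5
        rw [zero_pow (by positivity)] at h3
        exact absurd h3.symm hc.sign_ne_zero
      · rcases mul_eq_zero.1 h5 with h5 | h5
        · right
          exact eq_inv_of_mul_eq_one_left (sub_eq_zero.1 h5).symm
        · left
          rw [← inv_inv c]
          exact eq_inv_of_mul_eq_one_left (sub_eq_zero.1 h5).symm
    · rintro (h3 | h3)
      · rw [h2, h3, hS', mul_inv_cancel₀ h0]
        simp
      · rw [h2, h3, inv_pow, hS', inv_mul_cancel₀ h0]
        simp [hε]
  have h5 : m * (4 * (m + 1)) = Fintype.card F - 1 := by rw [h.card_sub_one]; ring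
  rw [h1, card_union_of_disjoint, card_filter_pow_eq h5 h4,
    card_filter_pow_eq h5 (by rw [inv_pow, h4, inv_one])]
  · ring
  · rw [Finset.disjoint_filter]
    rintro d - h6 h7
    apply hc.sq_ne_one
    rw [sq]
    nth_rewrite 1 [← h6]
    rw [h7, inv_mul_cancel₀ h0]

theorem card_zeros_of_line (hE : σ c = ε * c) :
    #{d : F | d ^ (2 * m * (m + 1)) = ε ∧ d + σ d - γ * d ^ (m + 1) = 0} = 0 := by
  have h0 := hc.ne_zero
  have hm := h.pos
  have hE' : c ^ (2 * m + 2) = ε * c ^ 2 := by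
    rw [sq, ← mul_assoc, ← hE, h.apply]; ring
  rw [card_eq_zero, filter_eq_empty_iff]
  rintro d - ⟨h3, h5⟩
  have h2 : d ^ (2 * m * (m + 1)) = (d ^ m) ^ (2 * m + 2) := by rw [← pow_mul]; ring
  have h6 : d ^ m = c ∨ d ^ m = c⁻¹ := by
    rw [hc.sub_mul_pow_eq h.apply] at h5
    rcases mul_eq_zero.1 h5 with h5 | h5
    · subst h5
      rw [zero_pow (by positivity)] at h3
      exact absurd h3.symm hc.sign_ne_zero
    · rcases mul_eq_zero.1 h5 with h5 | h5
      · right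
        exact eq_inv_of_mul_eq_one_left (sub_eq_zero.1 h5).symm
      · left
        rw [← inv_inv c]
        exact eq_inv_of_mul_eq_one_left (sub_eq_zero.1 h5).symm
  apply hc.sq_ne_one
  rcases h6 with h6 | h6
  · rw [h2, h6, hE'] at h3
    exact mul_left_cancel₀ hc.sign_ne_zero (by rw [h3, mul_one])
  · rw [h2, h6, inv_pow, hE', mul_inv] at h3
    have h7 : (c ^ 2)⁻¹ = 1 := by
      have h8 := hc.sign_ne_zero
      have h9 : ε⁻¹ = ε := inv_eq_of_mul_eq_one_left hc.sign
      rw [h9] at h3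
      exact mul_left_cancel₀ h8 (by rw [h3, mul_one])
    simpa using h7

/-- The number of affine solutions, circle type. -/
theorem card_affine_of_circle (hS : c * σ c = ε) :
    #{p : F × F | p.1 ≠ 0 ∧ p.1 + σ p.1 - p.2 * σ p.2 = γ * p.1 ^ (m + 1)} =
      m * (4 * m ^ 2 + 4 * m + 2) := by
  have h1 := h.card_affine hc.trace_ne_zero hc.sign (hc.conj_trace_of_circle hS)
  rw [hc.card_zeros_of_circle h hS] at h1
  nlinarith

/-- The number of affine solutions, line type. -/
theorem card_affine_of_line (hE : σ c = ε * c) :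
    #{p : F × F | p.1 ≠ 0 ∧ p.1 + σ p.1 - p.2 * σ p.2 = γ * p.1 ^ (m + 1)} =
      4 * m * (m + 1) ^ 2 := by
  have h1 := h.card_affine hc.trace_ne_zero hc.sign (hc.conj_trace_of_line hE)
  rw [hc.card_zeros_of_line h hE] at h1
  nlinarith

omit [DecidableEq F] in
theorem infinity_iff (r : F) :
    1 + r * σ r + γ * r ^ (m + 1) = 0 ↔ r ^ (m + 1) = -c ∨ r ^ (m + 1) = -c⁻¹ := by
  have h0 := hc.ne_zero
  have h1 : 1 + r * σ r + γ * r ^ (m + 1) = (r ^ (m + 1) + c) * (r ^ (m + 1) + c⁻¹) := by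
    rw [← h.pow_half_mul_self, hc.eq]
    field_simp
    ring
  rw [h1, mul_eq_zero, ← eq_neg_iff_add_eq_zero, ← eq_neg_iff_add_eq_zero]

theorem card_infinity_of_circle (hS : c * σ c = ε) :
    #{r : F | 1 + r * σ r + γ * r ^ (m + 1) = 0} = 0 := by
  have h0 := hc.ne_zero
  rw [card_eq_zero, filter_eq_empty_iff]
  intro r _ h1
  rw [hc.infinity_iff h] at h1
  have hS' : c ^ (2 * m + 2) = ε := by rw [← hS, h.apply]; ring
  have h4 : c ^ (4 * m) * c ^ 4 = 1 := by
    rw [← pow_add, show 4 * m + 4 = (2 * m + 2) * 2 by ring, pow_mul, hS', sq, hc.sign]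
  have hr : r ≠ 0 := by
    rintro rfl
    rw [zero_pow (by positivity)] at h1
    simp [eq_comm, h0] at h1
  have h2 : (r ^ (m + 1)) ^ (4 * m) = 1 := by
    rw [← pow_mul, show (m + 1) * (4 * m) = Fintype.card F - 1 by rw [h.card_sub_one]; ring,
      FiniteField.pow_card_sub_one_eq_one r hr]
  have hev : Even (4 * m) := ⟨2 * m, by ring⟩
  have h5 : c ^ (4 * m) = 1 := by
    rcases h1 with h1 | h1
    · rwa [h1, hev.neg_pow] at h2
    · rw [h1, hev.neg_pow, inv_pow] at h2
      exact inv_eq_one.1 h2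
  rw [h5, one_mul] at h4
  exact hc.pow_four_ne h4

theorem card_infinity_of_line (hE : σ c = ε * c) :
    #{r : F | 1 + r * σ r + γ * r ^ (m + 1) = 0} = 2 * m + 2 := by
  have h0 := hc.ne_zero
  have hE' : c ^ (2 * m) = ε := by
    apply mul_right_cancel₀ h0
    rw [← hE, h.apply, pow_succ]
  have hev : Even (4 * m) := ⟨2 * m, by ring⟩
  have h4 : (-c) ^ (4 * m) = 1 := by
    rw [hev.neg_pow, show 4 * m = 2 * m * 2 by ring, pow_mul, hE', sq, hc.sign]
  have h1 : univ.filter (fun r : F => 1 + r * σ r + γ * r ^ (m + 1) = 0) =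
      univ.filter (fun r : F => r ^ (m + 1) = -c) ∪
        univ.filter (fun r : F => r ^ (m + 1) = (-c)⁻¹) := by
    ext r
    simp only [mem_filter, mem_univ, true_and, mem_union, hc.infinity_iff h, inv_neg]
  have h5 : (m + 1) * (4 * m) = Fintype.card F - 1 := by rw [h.card_sub_one]; ring
  rw [h1, card_union_of_disjoint, card_filter_pow_eq h5 h4,
    card_filter_pow_eq h5 (by rw [inv_pow, h4, inv_one])]
  · ring
  · rw [Finset.disjoint_filter]
    rintro r - h6 h7
    rw [h6] at h7
    apply hc.sq_ne_one
    rw [inv_neg, neg_inj] at h7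
    rw [sq]
    nth_rewrite 1 [h7]
    rw [inv_mul_cancel₀ h0]

end IsTraceParam

/-- The determinant of the matrix with rows `(v 0, v 1)` and `(v 2, v 3)`. -/
def dett {F : Type*} [Field F] (v : Fin 4 → F) : F := v 0 * v 3 - v 1 * v 2

/-- The Hermitian form `Tr (σ v₀ v₃) - N v₁ - N v₂`. -/
def herm {F : Type*} [Field F] (σ : F →+* F) (v : Fin 4 → F) : F :=
  σ (v 0) * v 3 + v 0 * σ (v 3) - v 1 * σ (v 1) - v 2 * σ (v 2)

/-- The polar form of `dett`. -/
def polar {F : Type*} [Field F] (P v : Fin 4 → F) : F :=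
  P 0 * v 3 + P 3 * v 0 - P 1 * v 2 - P 2 * v 1

/-- The nonzero singular vectors of `dett` that are isotropic for `herm`. -/
def IsVertex {F : Type*} [Field F] (σ : F →+* F) (v : Fin 4 → F) : Prop :=
  v ≠ 0 ∧ dett v = 0 ∧ herm σ v = 0

/-- The zeros of `herm σ - γ * dett ^ (m + 1)` off the quadric `dett = 0`. -/
def IsGeneric {F : Type*} [Field F] (σ : F →+* F) (m : ℕ) (γ : F) (v : Fin 4 → F) : Prop :=
  dett v ≠ 0 ∧ herm σ v = γ * dett v ^ (m + 1)

instance {F : Type*} [Field F] [DecidableEq F] (σ : F →+* F) :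
    DecidablePred (IsVertex σ) := fun _ => inferInstanceAs (Decidable (_ ∧ _))

instance {F : Type*} [Field F] [DecidableEq F] (σ : F →+* F) (m : ℕ) (γ : F) :
    DecidablePred (IsGeneric σ m γ) := fun _ => inferInstanceAs (Decidable (_ ∧ _))

theorem fin_four_eq_zero_iff {F : Type*} [Field F] (v : Fin 4 → F) :
    v = 0 ↔ v 0 = 0 ∧ v 1 = 0 ∧ v 2 = 0 ∧ v 3 = 0 := by
  constructor
  · rintro rfl; simp
  · rintro ⟨h0, h1, h2, h3⟩
    ext i
    fin_cases i <;> assumption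

theorem card_filter_ne_zero (F : Type*) [Field F] [Fintype F] [DecidableEq F] :
    #{t : F | t ≠ 0} = Fintype.card F - 1 := by
  rw [Finset.filter_ne' univ (0 : F), card_erase_of_mem (mem_univ _), card_univ]

theorem card_filter_eq_of_inverse {α β : Type*} [Fintype α] [Fintype β] {p : α → Prop}
    {q : β → Prop} [DecidablePred p] [DecidablePred q] (f : α → β) (g : β → α)
    (hf : ∀ a, p a → q (f a) ∧ g (f a) = a) (hg : ∀ b, q b → p (g b) ∧ f (g b) = b) :
    #{a | p a} = #{b | q b} := by
  refine card_bij' (fun a _ => f a) (fun b _ => g b) (fun a ha => ?_) (fun b hb => ?_)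
    (fun a ha => ?_) (fun b hb => ?_)
  · exact mem_filter_univ _ |>.2 (hf a (mem_filter_univ a |>.1 ha)).1
  · exact mem_filter_univ _ |>.2 (hg b (mem_filter_univ b |>.1 hb)).1
  · exact (hf a (mem_filter_univ a |>.1 ha)).2
  · exact (hg b (mem_filter_univ b |>.1 hb)).2

theorem card_filter_prod {α β : Type*} [Fintype α] [Fintype β] (p : α → Prop)
    (q : β → Prop) [DecidablePred p] [DecidablePred q] :
    #{x : α × β | p x.1 ∧ q x.2} = #{a | p a} * #{b | q b} := by
  rw [← card_product, ← filter_product, univ_product_univ]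

namespace IsQuadExt

variable {F : Type*} [Field F] [Fintype F] [DecidableEq F] {σ : F →+* F} {m : ℕ}
  (h : IsQuadExt σ m)
include h

omit [DecidableEq F] in
theorem sq_pow_half (x : F) : (x ^ 2) ^ (m + 1) = x * σ x := by
  rw [← h.pow_half_mul_self]; ring

theorem card_isGeneric_infinity (γ : F) :
    #{v : Fin 4 → F | v 0 = 0 ∧ IsGeneric σ m γ v} =
      (Fintype.card F - 1) * Fintype.card F *
        #{r : F | 1 + r * σ r + γ * r ^ (m + 1) = 0} := by
  have h1 : #{p : F × F × F | 1 + p.1 * σ p.1 + γ * p.1 ^ (m + 1) = 0 ∧ p.2.1 ≠ 0 ∧ True} =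
      (Fintype.card F - 1) * Fintype.card F *
        #{r : F | 1 + r * σ r + γ * r ^ (m + 1) = 0} := by
    rw [card_filter_prod (fun r : F => 1 + r * σ r + γ * r ^ (m + 1) = 0)
      (fun s : F × F => s.1 ≠ 0 ∧ True), card_filter_prod (fun r : F => r ≠ 0) (fun _ : F => True),
      card_filter_ne_zero, filter_true, card_univ, mul_comm]
  rw [← h1]
  apply card_filter_eq_of_inverse (fun v => (-v 1 / v 2, v 2, v 3))
    (fun p => ![0, -p.1 * p.2.1, p.2.1, p.2.2])
  · rintro v ⟨h0, h1, h2⟩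
    simp only [dett, herm, h0, zero_mul, map_zero, zero_add, zero_sub] at h1 h2
    have h4 : v 2 ≠ 0 := by rintro h4; simp [h4] at h1
    have h6 : σ (v 2) ≠ 0 := by simpa using h4
    have h5 : -(v 1 * v 2) = -v 1 / v 2 * v 2 ^ 2 := by field_simp
    rw [h5, mul_pow, h.sq_pow_half] at h2
    refine ⟨⟨?_, h4, trivial⟩, ?_⟩
    · apply mul_right_cancel₀ (mul_ne_zero h4 h6)
      rw [add_mul, mul_assoc γ, ← h2]
      simp only [map_div₀, map_neg]
      field_simp
      ring
    · ext i
      fin_cases i <;> simp [h0]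
      field_simp
  · rintro ⟨r, z, w⟩ ⟨hr, hz, -⟩
    simp only at hr hz
    have hr0 : r ≠ 0 := by rintro rfl; simp at hr
    have h5 : -(-r * z * z) = r * z ^ 2 := by ring
    refine ⟨⟨by simp, by simp [dett, hz, hr0], ?_⟩, by simp [hz]⟩
    simp only [dett, herm, Matrix.cons_val, zero_mul, map_zero, zero_add, zero_sub, h5, mul_pow,
      h.sq_pow_half, map_mul, map_neg]
    linear_combination -(z * σ z) * hr

end IsQuadExt

/-- Normalized form of the vectors with nonzero first coordinate. -/
def chart {F : Type*} [Field F] (σ : F →+* F) (p : F × (F × F) × F) : Fin 4 → F :=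
  ![p.1, p.1 * (p.2.1.2 + σ p.2.2), p.1 * p.2.2,
    p.1 * (p.2.1.1 + (p.2.1.2 + σ p.2.2) * p.2.2)]

theorem dett_chart {F : Type*} [Field F] (σ : F →+* F) (p : F × (F × F) × F) :
    dett (chart σ p) = p.2.1.1 * p.1 ^ 2 := by
  simp [dett, chart]; ring

theorem isVertex_infinity {F : Type*} [Field F] {σ : F →+* F} {v : Fin 4 → F} (h0 : v 0 = 0) :
    IsVertex σ v ↔ v 1 = 0 ∧ v 2 = 0 ∧ v 3 ≠ 0 := by
  simp only [IsVertex, dett, herm, h0, fin_four_eq_zero_iff, Ne]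
  constructor
  · rintro ⟨h1, h2, h3⟩
    have h4 : v 1 = 0 ∨ v 2 = 0 := by simpa using h2
    rcases h4 with h4 | h4 <;> simp_all
  · rintro ⟨h1, h2, h3⟩
    simp_all

namespace IsQuadExt

variable {F : Type*} [Field F] [Fintype F] [DecidableEq F] {σ : F →+* F} {m : ℕ}
  (h : IsQuadExt σ m)
include h

omit [DecidableEq F] in
theorem herm_chart (p : F × (F × F) × F) :
    herm σ (chart σ p) = p.1 * σ p.1 * (p.2.1.1 + σ p.2.1.1 - p.2.1.2 * σ p.2.1.2) := by
  simp [herm, chart, h.conj_conj]; ring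

omit [DecidableEq F] in
theorem isGeneric_chart {γ : F} {p : F × (F × F) × F} (hp : p.1 ≠ 0) :
    IsGeneric σ m γ (chart σ p) ↔ p.2.1.1 ≠ 0 ∧
      p.2.1.1 + σ p.2.1.1 - p.2.1.2 * σ p.2.1.2 = γ * p.2.1.1 ^ (m + 1) := by
  have hp' : p.1 * σ p.1 ≠ 0 := by simpa using hp
  rw [IsGeneric, dett_chart, h.herm_chart, mul_pow, h.sq_pow_half]
  refine and_congr (by simp [hp]) ?_
  constructor
  · intro h1
    apply mul_left_cancel₀ hp'
    linear_combination h1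
  · intro h1
    linear_combination p.1 * σ p.1 * h1

omit [DecidableEq F] in
theorem isVertex_chart {p : F × (F × F) × F} (hp : p.1 ≠ 0) :
    IsVertex σ (chart σ p) ↔ p.2.1.1 = 0 ∧ p.2.1.2 = 0 := by
  have h0 : chart σ p ≠ 0 := by
    intro h0
    exact hp (by simpa [chart] using congrFun h0 0)
  rw [IsVertex, dett_chart, h.herm_chart]
  simp only [ne_eq, h0, not_false_eq_true, mul_eq_zero, hp, map_eq_zero, or_false, true_and,
    false_or, pow_eq_zero_iff (two_ne_zero' ℕ)]
  constructor
  · rintro ⟨h1, h2⟩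
    simpa [h1] using h2
  · rintro ⟨h1, h2⟩
    simp [h1, h2]

omit [Fintype F] [DecidableEq F] h in
theorem chart_surj {v : Fin 4 → F} (h0 : v 0 ≠ 0) :
    chart σ (v 0, (v 3 / v 0 - v 1 / v 0 * (v 2 / v 0), v 1 / v 0 - σ (v 2 / v 0)), v 2 / v 0)
      = v := by
  ext i
  fin_cases i <;> simp [chart] <;> field_simp

omit h in
theorem card_chart (P : (Fin 4 → F) → Prop) [DecidablePred P] :
    #{v : Fin 4 → F | v 0 ≠ 0 ∧ P v} = #{p : F × (F × F) × F | p.1 ≠ 0 ∧ P (chart σ p)} := by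
  apply card_filter_eq_of_inverse (fun v => (v 0, (v 3 / v 0 - v 1 / v 0 * (v 2 / v 0),
    v 1 / v 0 - σ (v 2 / v 0)), v 2 / v 0)) (chart σ)
  · rintro v ⟨h0, h1⟩
    rw [chart_surj h0]
    exact ⟨⟨h0, h1⟩, rfl⟩
  · rintro ⟨t, ⟨d, w⟩, x⟩ ⟨h0, h1⟩
    refine ⟨⟨by simpa [chart] using h0, h1⟩, ?_⟩
    simp only at h0
    simp only [chart, Matrix.cons_val, Prod.mk.injEq, true_and]
    simp only [mul_div_cancel_left₀ _ h0, add_sub_cancel_right, and_self]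

end IsQuadExt

theorem card_filter_split {α : Type*} [Fintype α] (q p : α → Prop)
    [DecidablePred p] [DecidablePred q] :
    #{a | p a} = #{a | q a ∧ p a} + #{a | ¬ q a ∧ p a} := by
  rw [← card_filter_add_card_filter_not (s := univ.filter p) q, filter_filter, filter_filter]
  simp only [and_comm]

namespace IsQuadExt

variable {F : Type*} [Field F] [Fintype F] [DecidableEq F] {σ : F →+* F} {m : ℕ}
  (h : IsQuadExt σ m)
include h

theorem card_isGeneric (γ : F) :
    #{v : Fin 4 → F | IsGeneric σ m γ v} = (Fintype.card F - 1) * Fintype.card F *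
      (#{p : F × F | p.1 ≠ 0 ∧ p.1 + σ p.1 - p.2 * σ p.2 = γ * p.1 ^ (m + 1)} +
        #{r : F | 1 + r * σ r + γ * r ^ (m + 1) = 0}) := by
  rw [card_filter_split (fun v : Fin 4 → F => v 0 = 0), h.card_isGeneric_infinity, card_chart (σ := σ)]
  have h1 : #{p : F × (F × F) × F | p.1 ≠ 0 ∧ IsGeneric σ m γ (chart σ p)} =
      #{p : F × (F × F) × F | p.1 ≠ 0 ∧
        ((p.2.1.1 ≠ 0 ∧ p.2.1.1 + σ p.2.1.1 - p.2.1.2 * σ p.2.1.2 = γ * p.2.1.1 ^ (m + 1)) ∧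
          True)} := by
    congr 1
    ext p
    simp only [mem_filter_univ, and_true]
    exact and_congr_right fun hp => h.isGeneric_chart hp
  rw [h1, card_filter_prod (fun t : F => t ≠ 0) (fun s : (F × F) × F =>
      (s.1.1 ≠ 0 ∧ s.1.1 + σ s.1.1 - s.1.2 * σ s.1.2 = γ * s.1.1 ^ (m + 1)) ∧ True),
    card_filter_prod (fun s : F × F =>
      s.1 ≠ 0 ∧ s.1 + σ s.1 - s.2 * σ s.2 = γ * s.1 ^ (m + 1)) (fun _ : F => True),
    card_filter_ne_zero, filter_true, card_univ]
  ring

omit h in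
theorem card_isVertex_infinity :
    #{v : Fin 4 → F | v 0 = 0 ∧ IsVertex σ v} = Fintype.card F - 1 := by
  rw [← card_filter_ne_zero]
  apply card_filter_eq_of_inverse (fun v => v 3) (fun t => ![0, 0, 0, t])
  · rintro v ⟨h0, h1⟩
    rw [isVertex_infinity h0] at h1
    refine ⟨h1.2.2, ?_⟩
    ext i
    fin_cases i <;> simp [h0, h1.1, h1.2.1]
  · intro t ht
    refine ⟨⟨rfl, ?_⟩, rfl⟩
    rw [isVertex_infinity rfl]
    exact ⟨rfl, rfl, ht⟩

/-- Vertices with nonzero first coordinate, subject to a further condition. -/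
theorem card_isVertex_affine (P : (Fin 4 → F) → Prop) [DecidablePred P] :
    #{v : Fin 4 → F | v 0 ≠ 0 ∧ P v ∧ IsVertex σ v} =
      #{p : F × F | p.1 ≠ 0 ∧ P ![p.1, p.1 * σ p.2, p.1 * p.2, p.1 * (σ p.2 * p.2)]} := by
  rw [card_chart (σ := σ)]
  have h0 : ∀ t x : F, chart σ (t, (0, 0), x) = ![t, t * σ x, t * x, t * (σ x * x)] := by
    intro t x
    simp [chart]
  apply card_filter_eq_of_inverse (fun p => (p.1, p.2.2)) (fun p => (p.1, (0, 0), p.2))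
  · rintro ⟨t, ⟨d, w⟩, x⟩ ⟨ht, h1, h2⟩
    obtain ⟨h3, h4⟩ := (h.isVertex_chart ht).1 h2
    simp only at h3 h4 ht
    subst h3 h4
    rw [h0] at h1
    exact ⟨⟨ht, h1⟩, rfl⟩
  · rintro ⟨t, x⟩ ⟨ht, h1⟩
    rw [← h0] at h1
    exact ⟨⟨ht, h1, (h.isVertex_chart (p := (t, (0, 0), x)) ht).2 ⟨rfl, rfl⟩⟩, rfl⟩

theorem card_isVertex :
    #{v : Fin 4 → F | IsVertex σ v} = (Fintype.card F - 1) * (Fintype.card F + 1) := by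
  have h1 := h.card_isVertex_affine (fun _ => True)
  simp only [true_and] at h1
  rw [card_filter_split (fun v : Fin 4 → F => v 0 = 0), card_isVertex_infinity, h1,
    card_filter_prod (fun t : F => t ≠ 0) (fun _ : F => True), card_filter_ne_zero, filter_true,
    card_univ]
  ring

end IsQuadExt

theorem card_filter_prod_of_fiber {α β : Type*} [Fintype α] [Fintype β] {R : α × β → Prop}
    {P : β → Prop} [DecidablePred R] [DecidablePred P] {k : ℕ}
    (h1 : ∀ b, P b → #{a | R (a, b)} = k) (h2 : ∀ a b, R (a, b) → P b) :
    #{p | R p} = k * #{b | P b} := by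
  have h3 : ∀ b, #{a | R (a, b)} = if P b then k else 0 := by
    intro b
    split_ifs with hb
    · exact h1 b hb
    · rw [card_eq_zero, filter_eq_empty_iff]
      exact fun a _ hR => hb (h2 a b hR)
  simp only [card_filter] at h3 ⊢
  rw [Fintype.sum_prod_type_right, mul_sum]
  exact sum_congr rfl fun b _ => by rw [h3 b]; split_ifs <;> simp

namespace IsQuadExt

variable {F : Type*} [Field F] [Fintype F] [DecidableEq F] {σ : F →+* F} {m : ℕ}
  (h : IsQuadExt σ m)
include h

theorem card_isGeneric_hyperbolic {γ a b : F} (ha : a ≠ 0) (hb : b ≠ 0)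
    (hab : a * σ a ≠ b * σ b) (hγ : -(a * σ a + b * σ b) = γ * (a * b) ^ (m + 1)) :
    #{v : Fin 4 → F | a * v 2 + b * v 1 = 0 ∧ IsGeneric σ m γ v} =
      (Fintype.card F - 1) * (Fintype.card F +
        #{p : F × F | p.1 ≠ 0 ∧ p.1 + σ p.1 - p.2 * σ p.2 = γ * p.1 ^ (m + 1)}) := by
  rw [card_filter_split (fun v : Fin 4 → F => v 0 = 0), card_chart (σ := σ), mul_add]
  congr 1
  · have h0 : Fintype.card F = #{x : F | True} := by rw [filter_true, card_univ]
    rw [← card_filter_ne_zero, h0, ← card_filter_prod]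
    apply card_filter_eq_of_inverse (fun v => (v 1 / a, v 3)) (fun p => ![0, a * p.1, -b * p.1, p.2])
    · rintro v ⟨h0, h1, h2, h3⟩
      have h4 : v 2 = -b * (v 1 / a) := by field_simp; linear_combination h1
      refine ⟨⟨?_, trivial⟩, ?_⟩
      · intro h5
        rw [show v 1 / a = 0 from h5, mul_zero] at h4
        simp [dett, h0, h4] at h2
      · ext i
        fin_cases i <;> simp [h0, h4]
        field_simp
    · rintro ⟨s, t⟩ ⟨hs, -⟩
      refine ⟨⟨rfl, by simp; ring, by simp [dett, ha, hb, hs], ?_⟩, by simp [ha]⟩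
      have h5 : dett ![0, a * s, -b * s, t] = a * b * s ^ 2 := by simp [dett]; ring
      rw [h5, mul_pow, h.sq_pow_half, ← mul_assoc, ← hγ]
      simp [herm]
      ring
  · rw [← card_filter_ne_zero, ← card_filter_prod]
    have hab' := sub_ne_zero.2 hab
    apply card_filter_eq_of_inverse (fun p => (p.1, p.2.1)) (fun p => (p.1, p.2,
      (b * σ (b * p.2.2) - σ a * (b * p.2.2)) / (a * σ a - b * σ b)))
    · rintro ⟨t, ⟨d, w⟩, x⟩ ⟨ht, h1, h2⟩
      simp only at ht
      have h3 : b * w = -(a * x + b * σ x) := by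
        apply mul_left_cancel₀ ht
        simp only [chart, Matrix.cons_val] at h1
        linear_combination h1
      refine ⟨⟨ht, (h.isGeneric_chart ht).1 h2⟩, ?_⟩
      simp only [h3, Prod.mk.injEq, true_and]
      rw [div_eq_iff hab']
      simp only [map_neg, map_add, map_mul, h.conj_conj]
      ring
    · rintro ⟨t, d, w⟩ ⟨ht, h1⟩
      simp only at ht
      refine ⟨⟨ht, ?_, (h.isGeneric_chart ht).2 h1⟩, rfl⟩
      have hab2 : σ a * a - σ b * b ≠ 0 := by
        rwa [mul_comm (σ a), mul_comm (σ b)]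
      simp only [chart, Matrix.cons_val, map_div₀, map_sub, map_mul, h.conj_conj]
      field_simp
      ring

theorem card_isVertex_hyperbolic {a b : F} (hab : a * σ a ≠ b * σ b) :
    #{v : Fin 4 → F | a * v 2 + b * v 1 = 0 ∧ IsVertex σ v} = 2 * (Fintype.card F - 1) := by
  rw [card_filter_split (fun v : Fin 4 → F => v 0 = 0), two_mul]
  congr 1
  · rw [← card_isVertex_infinity (σ := σ)]
    congr 1
    ext v
    simp only [mem_filter_univ]
    refine and_congr_right fun h0 => and_iff_right_of_imp fun h1 => ?_
    rw [isVertex_infinity h0] at h1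
    simp [h1.1, h1.2.1]
  · rw [h.card_isVertex_affine, ← card_filter_ne_zero]
    apply card_filter_eq_of_inverse (fun p => p.1) (fun t => (t, 0))
    · rintro ⟨t, x⟩ ⟨ht, h1⟩
      simp only [Matrix.cons_val] at ht h1
      have h2 : a * x + b * σ x = 0 := by
        apply mul_left_cancel₀ ht
        linear_combination h1
      have h3 : σ a * σ x + σ b * x = 0 := by
        have := congrArg σ h2
        simpa [h.conj_conj] using this
      have h4 : (a * σ a - b * σ b) * x = 0 := by
        linear_combination σ a * h2 - b * h3
      have h5 : x = 0 := by simpa [sub_eq_zero, hab] using h4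
      exact ⟨ht, by rw [h5]⟩
    · intro t ht
      exact ⟨⟨ht, by simp⟩, rfl⟩

omit [DecidableEq F] in
theorem sq_eq_four_of_conj_eq {γ a b : F} (ha : a ≠ 0) (hb : b ≠ 0)
    (hγ : σ a * b + a * σ b = γ * (a * b) ^ (m + 1)) (hab : σ a * b = a * σ b) : γ ^ 2 = 4 := by
  have ha' : σ a ≠ 0 := by simpa using ha
  have hb' : σ b ≠ 0 := by simpa using hb
  have h1 : (γ * (a * b) ^ (m + 1)) ^ 2 = γ ^ 2 * (a * b * (σ a * σ b)) := by
    rw [← map_mul, ← h.pow_half_mul_self]; ring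
  rw [← hγ] at h1
  apply mul_right_cancel₀ (mul_ne_zero (mul_ne_zero ha hb) (mul_ne_zero ha' hb'))
  rw [← h1]
  linear_combination (σ a * b - a * σ b) * hab

theorem card_isVertex_elliptic {γ a b : F} (ha : a ≠ 0) (hb : b ≠ 0)
    (hγ : σ a * b + a * σ b = γ * (a * b) ^ (m + 1)) (hγ4 : γ ^ 2 ≠ 4) :
    #{v : Fin 4 → F | a * v 3 = b * v 0 ∧ IsVertex σ v} = 0 := by
  rw [card_filter_split (fun v : Fin 4 → F => v 0 = 0), Nat.add_eq_zero_iff]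
  constructor
  · rw [card_eq_zero, filter_eq_empty_iff]
    rintro v - ⟨h0, h1, h2⟩
    rw [isVertex_infinity h0] at h2
    rw [h0, mul_zero] at h1
    simp [ha, h2.2.2] at h1
  · rw [h.card_isVertex_affine, card_eq_zero, filter_eq_empty_iff]
    rintro ⟨t, x⟩ - ⟨ht, h1⟩
    simp only [Matrix.cons_val] at ht h1
    have h2 : b = a * (σ x * x) := by
      apply mul_left_cancel₀ ht
      linear_combination -h1
    apply hγ4
    apply h.sq_eq_four_of_conj_eq ha hb hγ
    rw [h2]
    simp only [map_mul, h.conj_conj]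
    ring

end IsQuadExt

namespace IsQuadExt

variable {F : Type*} [Field F] [Fintype F] [DecidableEq F] {σ : F →+* F} {m : ℕ}
  (h : IsQuadExt σ m)
include h

theorem card_sq_eq {e : F} (he : e ^ (2 * m * (m + 1)) = 1) : #{x : F | x ^ 2 = e} = 2 :=
  card_filter_pow_eq (l := 2 * m * (m + 1)) (by rw [h.card_sub_one]; ring) he

omit [DecidableEq F] in
theorem conj_herm (v : Fin 4 → F) : σ (herm σ v) = herm σ v := by
  simp only [herm, map_sub, map_add, map_mul, h.conj_conj]; ring

/-- The number of `y` with `N y - (h₀/2) Tr y / n + 1/n = 0`. -/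
theorem card_trace_norm {γ a b : F} (ha : a ≠ 0) (hb : b ≠ 0)
    (hγ : σ a * b + a * σ b = γ * (a * b) ^ (m + 1)) (hγ4 : γ ^ 2 ≠ 4) :
    #{y : F | 2 * (1 + a * b * (σ a * σ b) * (y * σ y)) = (σ a * b + a * σ b) * (y + σ y)} =
      2 * m + 2 := by
  have h2 := h.two_ne_zero
  have ha' : σ a ≠ 0 := by simpa using ha
  have hb' : σ b ≠ 0 := by simpa using hb
  have hne : σ a * b ≠ a * σ b := fun h3 => hγ4 (h.sq_eq_four_of_conj_eq ha hb hγ h3)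
  have ht0 : (σ a * b - a * σ b) ^ 2 / (2 * (a * b * (σ a * σ b))) ^ 2 ≠ 0 :=
    div_ne_zero (pow_ne_zero _ (sub_ne_zero.2 hne)) (by simp [h2, ha, hb])
  have ht : σ ((σ a * b - a * σ b) ^ 2 / (2 * (a * b * (σ a * σ b))) ^ 2) =
      (σ a * b - a * σ b) ^ 2 / (2 * (a * b * (σ a * σ b))) ^ 2 := by
    simp only [map_div₀, map_pow, map_sub, map_mul, h.conj_conj, map_ofNat]
    ring
  have h3 := h.card_mul_conj_eq ht
  rw [if_neg ht0] at h3
  rw [← h3]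
  have hy0 : σ ((σ a * b + a * σ b) / (2 * (a * b * (σ a * σ b)))) =
      (σ a * b + a * σ b) / (2 * (a * b * (σ a * σ b))) := by
    simp only [map_div₀, map_add, map_mul, h.conj_conj, map_ofNat]
    ring
  set y₀ := (σ a * b + a * σ b) / (2 * (a * b * (σ a * σ b))) with hy
  apply card_filter_eq_of_inverse (fun y => y - y₀) (fun y => y + y₀)
  · intro y h4
    refine ⟨?_, by ring⟩
    rw [map_sub, hy0, hy]
    field_simp
    linear_combination 2 * a * b * (σ a * σ b) * h4
  · intro y h4
    refine ⟨?_, by ring⟩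
    rw [map_add, hy0]
    rw [eq_div_iff (by simp [h2, ha, hb])] at h4
    apply mul_left_cancel₀ (show 2 * (a * b * (σ a * σ b)) ≠ 0 by simp [h2, ha, hb])
    have h5 : 2 * (a * b * (σ a * σ b)) * y₀ = σ a * b + a * σ b := by
      rw [hy]; field_simp
    clear_value y₀
    linear_combination h4 + (2 * (a * b * (σ a * σ b)) * (y + σ y + y₀) -
      (σ a * b + a * σ b)) * h5


theorem card_elliptic_cover {γ a b : F} (ha : a ≠ 0) (hb : b ≠ 0)
    (hγ : σ a * b + a * σ b = γ * (a * b) ^ (m + 1)) {ε : F} (hγ0 : γ ≠ 0)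
    (hε : ε * ε = 1) (hγε : σ γ = ε * γ) :
    #{p : F × (Fin 4 → F) | p.1 ≠ 0 ∧ a * p.2 3 = b * p.2 0 ∧ dett p.2 = a * b * p.1 ^ 2 ∧
      herm σ p.2 = (σ a * b + a * σ b) * (p.1 * σ p.1)} =
    2 * #{v : Fin 4 → F | a * v 3 = b * v 0 ∧ IsGeneric σ m γ v} := by
  have hab : a * b ≠ 0 := mul_ne_zero ha hb
  have hab' : (a * b) ^ (2 * m * (m + 1)) = ε := by
    rw [← h.conj_eq_iff hγ0 hε hγε hab, ← hγ]
    simp only [map_add, map_mul, h.conj_conj]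
    ring
  have hε0 : ε ≠ 0 := by rintro rfl; simp at hε
  have key : ∀ w : F, (σ a * b + a * σ b) * (w * σ w) = γ * (a * b * w ^ 2) ^ (m + 1) := by
    intro w
    rw [hγ, mul_pow (a * b), h.sq_pow_half]; ring
  apply card_filter_prod_of_fiber
  · rintro v ⟨h1, h2, h3⟩
    have h4 : dett v ^ (2 * m * (m + 1)) = ε := by
      rw [← h.conj_eq_iff hγ0 hε hγε h2, ← h3, h.conj_herm]
    have h5 : (dett v / (a * b)) ^ (2 * m * (m + 1)) = 1 := by
      rw [div_pow, h4, hab', div_self hε0]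
    refine Eq.trans ?_ (h.card_sq_eq h5)
    congr 1
    ext w
    simp only [mem_filter_univ]
    rw [eq_div_iff hab]
    constructor
    · rintro ⟨-, -, h6, -⟩
      rw [h6]; ring
    · intro h6
      have h7 : dett v = a * b * w ^ 2 := by rw [← h6]; ring
      refine ⟨?_, h1, h7, ?_⟩
      · rintro rfl
        simp [h7] at h2
      · rw [h3, h7, key]
  · rintro w v ⟨h1, h2, h3, h4⟩
    refine ⟨h2, ?_, ?_⟩
    · rw [h3]
      simp [hab, h1]
    · rw [h4, h3, key]

omit [Fintype F] [DecidableEq F] h in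
theorem herm_of_plane {a b : F} (ha : a ≠ 0) {v : Fin 4 → F} (h1 : a * v 3 = b * v 0) :
    v 0 = a * (v 0 / a) ∧ v 3 = b * (v 0 / a) := by
  constructor <;> field_simp
  linear_combination h1

theorem card_elliptic_cover_diag {a b : F} (ha : a ≠ 0) :
    #{p : F × (Fin 4 → F) | (p.2 0 / a) ^ 2 = p.1 ^ 2 ∧
      (p.1 ≠ 0 ∧ a * p.2 3 = b * p.2 0 ∧ dett p.2 = a * b * p.1 ^ 2 ∧
      herm σ p.2 = (σ a * b + a * σ b) * (p.1 * σ p.1))} = 2 * (Fintype.card F - 1) := by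
  have h0 : 2 * (Fintype.card F - 1) = #{t : F | t ≠ 0} * #{e : F | e ^ 2 = 1} := by
    rw [card_filter_ne_zero, h.card_sq_eq (one_pow _), mul_comm]
  rw [h0, ← card_filter_prod]
  apply card_filter_eq_of_inverse (fun p => (p.1, p.2 0 / a / p.1))
    (fun p => (p.1, ![a * (p.1 * p.2), 0, 0, b * (p.1 * p.2)]))
  · rintro ⟨w, v⟩ ⟨h1, h2, h3, h4, h5⟩
    simp only at h1 h2 h3 h4 h5
    obtain ⟨h6, h7⟩ := herm_of_plane ha h3
    set s := v 0 / a
    clear_value s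
    have h8 : v 1 * v 2 = 0 := by
      simp only [dett, h6, h7] at h4
      linear_combination a * b * h1 - h4
    have h9 : s * σ s = w * σ w := by
      rw [← h.sq_pow_half, ← h.sq_pow_half, h1]
    have h10 : v 1 * σ (v 1) + v 2 * σ (v 2) = 0 := by
      simp only [herm, h6, h7, map_mul] at h5
      linear_combination (σ a * b + a * σ b) * h9 - h5
    have h11 : v 1 = 0 ∧ v 2 = 0 := by
      rcases mul_eq_zero.1 h8 with h11 | h11 <;> simp [h11] at h10 <;> simp [h11, h10]
    refine ⟨⟨h2, ?_⟩, ?_⟩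
    · rw [div_pow, h1, div_self (pow_ne_zero _ h2)]
    · simp only [Prod.mk.injEq, true_and]
      ext i
      fin_cases i <;> simp [h6, h7, h11] <;> field_simp <;> simp
  · rintro ⟨w, e⟩ ⟨h1, h2⟩
    simp only at h1 h2
    have h3 : e * σ e = 1 := by rw [← h.sq_pow_half, h2, one_pow]
    refine ⟨⟨?_, h1, ?_, ?_, ?_⟩, ?_⟩
    · simp [ha, mul_pow, h2]
    · simp; ring
    · simp [dett]
      linear_combination a * b * w ^ 2 * h2
    · simp [herm]
      linear_combination (σ a * b + a * σ b) * w * σ w * h3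
    · simp only [Matrix.cons_val, Prod.mk.injEq, true_and]
      field_simp

theorem card_elliptic_cover_off_diag {γ a b : F} (ha : a ≠ 0) (hb : b ≠ 0)
    (hγ : σ a * b + a * σ b = γ * (a * b) ^ (m + 1)) (hγ4 : γ ^ 2 ≠ 4) :
    #{p : F × (Fin 4 → F) | ¬ (p.2 0 / a) ^ 2 = p.1 ^ 2 ∧
      (p.1 ≠ 0 ∧ a * p.2 3 = b * p.2 0 ∧ dett p.2 = a * b * p.1 ^ 2 ∧
      herm σ p.2 = (σ a * b + a * σ b) * (p.1 * σ p.1))} =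
      (Fintype.card F - 1) * (Fintype.card F - 1) * (2 * m + 2) := by
  have ha' : σ a ≠ 0 := by simpa using ha
  have hb' : σ b ≠ 0 := by simpa using hb
  have htwo := h.two_ne_zero
  have hne : σ a * b ≠ a * σ b := fun h3 => hγ4 (h.sq_eq_four_of_conj_eq ha hb hγ h3)
  rw [← h.card_trace_norm ha hb hγ hγ4, mul_assoc, ← card_filter_ne_zero, ← card_filter_prod,
    ← card_filter_prod]
  apply card_filter_eq_of_inverse
    (fun p : F × (Fin 4 → F) => (p.2 0 / a - p.1, p.2 1 / (p.2 0 / a - p.1),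
      (p.2 0 / a + p.1) / ((p.2 1 / (p.2 0 / a - p.1)) * σ (p.2 1 / (p.2 0 / a - p.1)) *
        (p.2 0 / a - p.1))))
    (fun p : F × F × F => ((p.2.1 * σ p.2.1 * p.2.2 * p.1 - p.1) / 2,
      ![a * ((p.2.1 * σ p.2.1 * p.2.2 * p.1 + p.1) / 2), p.2.1 * p.1,
        a * b * (σ p.2.1 * p.2.2 * p.1),
        b * ((p.2.1 * σ p.2.1 * p.2.2 * p.1 + p.1) / 2)]))
  · rintro ⟨w, v⟩ ⟨h1, h2, h3, h4, h5⟩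
    simp only at h1 h2 h3 h4 h5
    obtain ⟨h6, h7⟩ := herm_of_plane ha h3
    simp only
    set s := v 0 / a
    clear_value s
    obtain ⟨l, hl⟩ : ∃ l, l = s - w := ⟨_, rfl⟩
    obtain ⟨k, hk⟩ : ∃ k, k = s + w := ⟨_, rfl⟩
    rw [← hl, ← hk]
    have hs : s = (k + l) / 2 := by rw [hl, hk]; field_simp; ring
    have hw : w = (k - l) / 2 := by rw [hl, hk]; field_simp; ring
    have hl0 : l ≠ 0 := by rintro rfl; exact h1 (by linear_combination -(s + w) * hl)
    have hk0 : k ≠ 0 := by rintro rfl; exact h1 (by linear_combination -(s - w) * hk)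
    have hl' : σ l ≠ 0 := by simpa using hl0
    have h8 : v 1 * v 2 = a * b * (l * k) := by
      simp only [dett, h6, h7] at h4
      rw [hl, hk]
      linear_combination -h4
    obtain ⟨x, hx⟩ : ∃ x, x = v 1 / l := ⟨_, rfl⟩
    have hx1 : v 1 = x * l := by rw [hx]; field_simp
    have hx0 : x ≠ 0 := by
      rintro rfl
      rw [hx1] at h8
      simp [ha, hb, hl0, hk0] at h8
    have hx' : σ x ≠ 0 := by simpa using hx0
    rw [← hx]
    obtain ⟨y, hy⟩ : ∃ y, y = k / (x * σ x * l) := ⟨_, rfl⟩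
    have hy1 : k = x * σ x * y * l := by rw [hy]; field_simp
    rw [← hy]
    have h9 : v 2 = a * b * (σ x * y * l) := by
      apply mul_left_cancel₀ (mul_ne_zero hx0 hl0)
      rw [← hx1, h8, hx1, hy1]
      ring
    refine ⟨⟨hl0, hx0, ?_⟩, ?_⟩
    · apply mul_left_cancel₀ (mul_ne_zero (mul_ne_zero hx0 hx') (mul_ne_zero hl0 hl'))
      simp only [herm, h6, h7, h9, hx1, hs, hw, hy1, map_mul, map_div₀, map_add, map_sub,
        map_ofNat, h.conj_conj] at h5
      field_simp at h5
      apply mul_left_cancel₀ htwo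
      linear_combination -(l * σ l) * h5
    · simp only [Prod.mk.injEq]
      refine ⟨by rw [hw, hy1], ?_⟩
      ext i
      fin_cases i
      · simp [h6, hs, hy1]
      · simp [hx1]
      · simp [h9]
      · simp [h7, hs, hy1]
  · rintro ⟨l, x, y⟩ ⟨hl, hx, hy⟩
    simp only at hl hx hy
    have hx' : σ x ≠ 0 := by simpa using hx
    have hy0 : y ≠ 0 := by rintro rfl; simp [htwo] at hy
    have hs : a * ((x * σ x * y * l + l) / 2) / a = (x * σ x * y * l + l) / 2 := by
      field_simp
    refine ⟨⟨?_, ?_, ?_, ?_, ?_⟩, ?_⟩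
    · simp only [Matrix.cons_val, hs]
      intro h1
      have h2 : x * σ x * y * l * l = 0 := by
        field_simp at h1
        apply mul_left_cancel₀ (mul_ne_zero htwo htwo)
        linear_combination l ^ 2 * h1
      simp [hx, hy0, hl] at h2
    · intro h1
      apply hne
      simp only at h1
      have h2 : x * σ x * y = 1 := by
        apply mul_right_cancel₀ hl
        field_simp at h1
        linear_combination h1
      have h3 : σ x * x * σ y = 1 := by
        simpa [h.conj_conj] using congrArg σ h2
      have h4 : σ y = y := by
        apply mul_left_cancel₀ (mul_ne_zero hx hx')
        linear_combination h3 - h2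
      have h5 : (σ a * b * y - 1) * (a * σ b * y - 1) = 0 := by
        apply mul_left_cancel₀ htwo
        rw [h4] at hy
        linear_combination hy
      apply mul_right_cancel₀ hy0
      rcases mul_eq_zero.1 h5 with h5 | h5
      all_goals
        have h6 := congrArg σ h5
        simp only [map_sub, map_mul, h.conj_conj, h4, map_one, map_zero] at h6
      · linear_combination h5 - h6
      · linear_combination h6 - h5
    · simp; ring
    · simp [dett]
      field_simp
      ring
    · simp only [herm, Matrix.cons_val, map_mul, map_div₀, map_add, map_sub,
        map_ofNat, h.conj_conj]
      field_simp
      linear_combination -(2 * x * σ x * σ l) * hy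
    · simp only [Matrix.cons_val, hs, Prod.mk.injEq]
      have h1 : (x * σ x * y * l + l) / 2 - (x * σ x * y * l - l) / 2 = l := by
        field_simp; ring
      have h2 : (x * σ x * y * l + l) / 2 + (x * σ x * y * l - l) / 2 = x * σ x * y * l := by
        field_simp; ring
      rw [h1, h2]
      refine ⟨rfl, ?_, ?_⟩
      all_goals field_simp

end IsQuadExt

section Plancherel

variable {F ι : Type*} [Field F] [Fintype F] [DecidableEq F] [Fintype ι] [DecidableEq ι]

theorem sum_primitiveChar_dotProduct {ψ : AddChar F ℂ} (hψ : ψ.IsPrimitive) (u : ι → F) :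
    ∑ a : ι → F, ψ (a ⬝ᵥ u) =
      if u = 0 then (Fintype.card F : ℂ) ^ Fintype.card ι else 0 := by
  have h1 : ∀ a : ι → F, ψ (a ⬝ᵥ u) = ∏ i, ψ (a i * u i) := by
    intro a
    exact map_prod ψ.toMonoidHom (fun i => Multiplicative.ofAdd (a i * u i)) univ
  simp only [h1]
  rw [← Fintype.piFinset_univ, ← prod_univ_sum (fun _ => univ) (fun i x => ψ (x * u i))]
  simp only [AddChar.sum_mulShift _ hψ]
  split_ifs with h2
  · simp [h2]
  · obtain ⟨i, hi⟩ := Function.ne_iff.1 h2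
    exact prod_eq_zero (mem_univ i) (by simpa using hi)

/-- A Plancherel identity for the hyperplane sums of a function constant on punctured lines. -/
theorem sum_sq_hyperplane (g : (ι → F) → ℤ) (hg : ∀ (t : F) v, t ≠ 0 → g (t • v) = g v) :
    ∑ a : ι → F, ((Fintype.card F : ℤ) * ∑ v with a ⬝ᵥ v = 0, g v - ∑ v, g v) ^ 2 =
      (Fintype.card F : ℤ) ^ Fintype.card ι * ((Fintype.card F : ℤ) - 1) ^ 2 * ∑ v, g v ^ 2 := by
  obtain ⟨ψ, hψ⟩ : ∃ ψ : AddChar F ℂ, ψ.IsPrimitive :=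
    ⟨_, AddChar.FiniteField.primitiveChar_to_Complex_isPrimitive F⟩
  have h1 : ∀ (a : ι → F) (t : F), t ≠ 0 →
      ∑ v, ψ (t * a ⬝ᵥ v) * (g v : ℂ) = ∑ v, ψ (a ⬝ᵥ v) * (g v : ℂ) := by
    intro a t ht
    refine Fintype.sum_equiv (LinearEquiv.smulOfNeZero F (ι → F) t ht).toEquiv _ _ fun v => ?_
    have h2 : g (t • v) = g v := hg t v ht
    simp [h2, dotProduct_smul]
  have h2 : ∀ a : ι → F, (((Fintype.card F : ℤ) * ∑ v with a ⬝ᵥ v = 0, g v - ∑ v, g v : ℤ) : ℂ) =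
      ((Fintype.card F : ℂ) - 1) * ∑ v, ψ (a ⬝ᵥ v) * (g v : ℂ) := by
    intro a
    have h3 : ∑ t : F, ∑ v, ψ (t * a ⬝ᵥ v) * (g v : ℂ) =
        Fintype.card F * ∑ v with a ⬝ᵥ v = 0, (g v : ℂ) := by
      rw [sum_comm, sum_filter, mul_sum]
      refine sum_congr rfl fun v _ => ?_
      rw [← sum_mul, AddChar.sum_mulShift _ hψ]
      split_ifs <;> simp
    rw [← add_sum_erase _ _ (mem_univ (0 : F)),
      sum_congr rfl fun t ht => h1 a t (ne_of_mem_erase ht), sum_const,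
      card_erase_of_mem (mem_univ _), card_univ, nsmul_eq_mul,
      Nat.cast_sub Fintype.card_pos] at h3
    push_cast
    rw [← h3]
    simp
  have h3 : ∑ a : ι → F, (∑ v, ψ (a ⬝ᵥ v) * (g v : ℂ)) ^ 2 =
      (Fintype.card F : ℂ) ^ Fintype.card ι * ∑ v, (g v : ℂ) ^ 2 := by
    have h4 : ∀ a : ι → F, (∑ v, ψ (a ⬝ᵥ v) * (g v : ℂ)) ^ 2 =
        ∑ v, ∑ w, (g v : ℂ) * g w * ψ (a ⬝ᵥ (v - w)) := by
      intro a
      rw [sq]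
      nth_rewrite 2 [← h1 a (-1) (by simp)]
      rw [sum_mul_sum]
      refine sum_congr rfl fun v _ => sum_congr rfl fun w _ => ?_
      rw [dotProduct_sub, sub_eq_add_neg, AddChar.map_add_eq_mul, neg_one_mul]
      ring
    simp only [h4]
    rw [sum_comm, mul_sum]
    refine sum_congr rfl fun v _ => ?_
    rw [sum_comm]
    simp only [← mul_sum, sum_primitiveChar_dotProduct hψ, sub_eq_zero]
    simp
    ring
  have h5 : ((∑ a : ι → F,
      ((Fintype.card F : ℤ) * ∑ v with a ⬝ᵥ v = 0, g v - ∑ v, g v) ^ 2 : ℤ) : ℂ) =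
      (((Fintype.card F : ℤ) ^ Fintype.card ι * ((Fintype.card F : ℤ) - 1) ^ 2 *
        ∑ v, g v ^ 2 : ℤ) : ℂ) := by
    rw [Int.cast_sum]
    simp only [Int.cast_pow, h2, mul_pow]
    rw [← mul_sum, h3]
    push_cast
    ring
  exact_mod_cast h5

/-- If the hyperplane transform of `g` is known to be `c • g'` on the support of `g'`, and `g`,
`g'` have the same norm, then it is `c • g'` everywhere. -/
theorem hyperplane_transform_eq (g g' : (ι → F) → ℤ) (hg : ∀ (t : F) v, t ≠ 0 → g (t • v) = g v)
    {c : ℤ} (hc : c ^ 2 = (Fintype.card F : ℤ) ^ Fintype.card ι * ((Fintype.card F : ℤ) - 1) ^ 2)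
    (hnorm : ∑ v, g' v ^ 2 = ∑ v, g v ^ 2)
    (hsupp : ∀ a, g' a ≠ 0 →
      (Fintype.card F : ℤ) * ∑ v with a ⬝ᵥ v = 0, g v - ∑ v, g v = c * g' a) (a : ι → F) :
    (Fintype.card F : ℤ) * ∑ v with a ⬝ᵥ v = 0, g v - ∑ v, g v = c * g' a := by
  have h1 := sum_sq_hyperplane g hg
  set T : (ι → F) → ℤ := fun a => (Fintype.card F : ℤ) * ∑ v with a ⬝ᵥ v = 0, g v - ∑ v, g v
  have h2 : ∑ a, (T a - c * g' a) ^ 2 = 0 := by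
    have h3 : ∀ a, (T a - c * g' a) ^ 2 = T a ^ 2 - c ^ 2 * g' a ^ 2 := by
      intro a
      by_cases ha : g' a = 0
      · rw [ha]; ring
      · rw [show T a = c * g' a from hsupp a ha]; ring
    simp only [h3]
    rw [sum_sub_distrib, ← mul_sum, hnorm, h1, hc, sub_self]
  have h4 := (sum_eq_zero_iff_of_nonneg fun a _ => sq_nonneg (T a - c * g' a)).1 h2 a (mem_univ a)
  exact sub_eq_zero.1 (pow_eq_zero_iff two_ne_zero |>.1 h4)

end Plancherel

/-- The sesquilinear form of the `2 × 2` matrix with entries `v`. -/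
def sesq {F : Type*} [Field F] (σ : F →+* F) (v : Fin 4 → F) (k l : F × F) : F :=
  σ k.1 * (v 0 * l.1 + v 1 * l.2) + σ k.2 * (v 2 * l.1 + v 3 * l.2)

/-- The congruence action `M ↦ A* M A` where `A` has columns `k` and `l`. -/
def congAct {F : Type*} [Field F] (σ : F →+* F) (k l : F × F) (v : Fin 4 → F) : Fin 4 → F :=
  ![sesq σ v k k, sesq σ v k l, sesq σ v l k, sesq σ v l l]

theorem exists_kernel_pair {F : Type*} [Field F] {p q r s : F} (hdet : p * s - q * r = 0) :
    ∃ k : F × F, k ≠ 0 ∧ p * k.1 + q * k.2 = 0 ∧ r * k.1 + s * k.2 = 0 := by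
  by_cases h1 : ((-q, p) : F × F) = 0
  · rw [Prod.mk_eq_zero] at h1
    obtain ⟨hq, hp⟩ := h1
    by_cases h2 : ((-s, r) : F × F) = 0
    · rw [Prod.mk_eq_zero] at h2
      obtain ⟨hs, hr⟩ := h2
      refine ⟨(1, 0), by simp, ?_, ?_⟩ <;> simp_all
    · refine ⟨(-s, r), h2, ?_, ?_⟩ <;> simp_all
      ring
  · exact ⟨(-q, p), h1, by ring, by linear_combination hdet⟩

theorem polar_congAct {F : Type*} [Field F] (σ : F →+* F) (k l : F × F) (v w : Fin 4 → F) :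
    polar (congAct σ k l v) (congAct σ k l w) =
      (k.1 * l.2 - k.2 * l.1) * σ (k.1 * l.2 - k.2 * l.1) * polar v w := by
  simp [polar, congAct, sesq]; ring

theorem dett_congAct {F : Type*} [Field F] (σ : F →+* F) (k l : F × F) (v : Fin 4 → F) :
    dett (congAct σ k l v) =
      (k.1 * l.2 - k.2 * l.1) * σ (k.1 * l.2 - k.2 * l.1) * dett v := by
  simp [dett, congAct, sesq]; ring

theorem congAct_congAct {F : Type*} [Field F] (σ : F →+* F) {k l : F × F}
    (hkl : k.1 * l.2 - k.2 * l.1 = 1) (v : Fin 4 → F) :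
    congAct σ (l.2, -k.2) (-l.1, k.1) (congAct σ k l v) = v := by
  have h1 : σ k.1 * σ l.2 - σ k.2 * σ l.1 = 1 := by
    rw [← map_mul, ← map_mul, ← map_sub, hkl, map_one]
  have h2 : ∀ i, congAct σ (l.2, -k.2) (-l.1, k.1) (congAct σ k l v) i =
      (k.1 * l.2 - k.2 * l.1) * (σ k.1 * σ l.2 - σ k.2 * σ l.1) * v i := by
    intro i
    fin_cases i <;> simp [congAct, sesq] <;> ring
  ext i
  rw [h2, hkl, h1]; ring

/-- The congruence action of a matrix of determinant one, as a permutation. -/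
def congEquiv {F : Type*} [Field F] (σ : F →+* F) {k l : F × F}
    (hkl : k.1 * l.2 - k.2 * l.1 = 1) : (Fin 4 → F) ≃ (Fin 4 → F) where
  toFun := congAct σ k l
  invFun := congAct σ (l.2, -k.2) (-l.1, k.1)
  left_inv := congAct_congAct σ hkl
  right_inv v := by
    have := congAct_congAct σ (k := (l.2, -k.2)) (l := (-l.1, k.1)) (by linear_combination hkl) v
    simpa using this

theorem congAct_eq_zero_iff {F : Type*} [Field F] (σ : F →+* F) {k l : F × F}
    (hkl : k.1 * l.2 - k.2 * l.1 = 1) (v : Fin 4 → F) : congAct σ k l v = 0 ↔ v = 0 := by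
  have h0 : congEquiv σ hkl 0 = 0 := by
    ext i
    fin_cases i <;> simp [congEquiv, congAct, sesq]
  rw [show congAct σ k l v = congEquiv σ hkl v from rfl, ← h0, (congEquiv σ hkl).injective.eq_iff,
    h0]

namespace IsQuadExt

variable {F : Type*} [Field F] [Fintype F] {σ : F →+* F} {m : ℕ} (h : IsQuadExt σ m)
include h

theorem herm_congAct (k l : F × F) (v : Fin 4 → F) :
    herm σ (congAct σ k l v) =
      (k.1 * l.2 - k.2 * l.1) * σ (k.1 * l.2 - k.2 * l.1) * herm σ v := by
  simp [herm, congAct, sesq, h.conj_conj]; ring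

theorem isVertex_congAct {k l : F × F} (hkl : k.1 * l.2 - k.2 * l.1 = 1) (v : Fin 4 → F) :
    IsVertex σ (congAct σ k l v) ↔ IsVertex σ v := by
  rw [IsVertex, IsVertex, h.herm_congAct, dett_congAct, hkl, Ne, congAct_eq_zero_iff σ hkl]
  simp

theorem isGeneric_congAct {k l : F × F} (hkl : k.1 * l.2 - k.2 * l.1 = 1) (γ : F)
    (v : Fin 4 → F) : IsGeneric σ m γ (congAct σ k l v) ↔ IsGeneric σ m γ v := by
  rw [IsGeneric, IsGeneric, h.herm_congAct, dett_congAct, hkl]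
  simp

theorem exists_congAct_of_isVertex {v : Fin 4 → F} (hv : IsVertex σ v) :
    ∃ k l : F × F, k.1 * l.2 - k.2 * l.1 = 1 ∧ ∃ p ≠ 0, congAct σ k l v = ![0, 0, 0, p] := by
  have key : ∃ k l : F × F, k.1 * l.2 - k.2 * l.1 = 1 ∧ congAct σ k l v 0 = 0 := by
    by_cases h0 : v 0 = 0
    · exact ⟨(1, 0), (0, 1), by simp, by simp [congAct, sesq, h0]⟩
    · refine ⟨(-v 1 / v 0, 1), (-1, 0), by simp, ?_⟩
      have h1 := hv.2.1
      simp only [dett] at h1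
      simp only [congAct, sesq, Matrix.cons_val, map_one]
      field_simp
      linear_combination h1
  obtain ⟨k, l, hkl, h0⟩ := key
  have h1 := (h.isVertex_congAct hkl v).2 hv
  obtain ⟨h2, h3, h4⟩ := (isVertex_infinity h0).1 h1
  refine ⟨k, l, hkl, _, h4, ?_⟩
  ext i
  fin_cases i <;> simp [h0, h2, h3]

/-- Simultaneous diagonalization of `M` and `M*`. -/
theorem exists_congAct_eigen {v : Fin 4 → F} {s t : F} (hd : dett v ≠ 0) (hst : s ≠ t)
    (hs : dett v + s * herm σ v + s ^ 2 * σ (dett v) = 0)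
    (ht : dett v + t * herm σ v + t ^ 2 * σ (dett v) = 0) :
    ∃ k l : F × F, k.1 * l.2 - k.2 * l.1 = 1 ∧
      congAct σ k l v 0 = -s * σ (congAct σ k l v 0) ∧
      congAct σ k l v 1 = -t * σ (congAct σ k l v 2) ∧
      congAct σ k l v 2 = -s * σ (congAct σ k l v 1) ∧
      congAct σ k l v 3 = -t * σ (congAct σ k l v 3) := by
  have key : ∀ r : F, dett v + r * herm σ v + r ^ 2 * σ (dett v) = 0 →
      ∃ k : F × F, k ≠ 0 ∧ v 0 * k.1 + v 1 * k.2 = -r * (σ (v 0) * k.1 + σ (v 2) * k.2) ∧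
        v 2 * k.1 + v 3 * k.2 = -r * (σ (v 1) * k.1 + σ (v 3) * k.2) := by
    intro r hr
    obtain ⟨k, hk, h1, h2⟩ := exists_kernel_pair (p := v 0 + r * σ (v 0))
      (q := v 1 + r * σ (v 2)) (r := v 2 + r * σ (v 1)) (s := v 3 + r * σ (v 3)) (by
        simp only [dett, herm, map_sub, map_mul] at hr
        linear_combination hr)
    exact ⟨k, hk, by linear_combination h1, by linear_combination h2⟩
  obtain ⟨k, hk, hk1, hk2⟩ := key s hs
  obtain ⟨l, hl, hl1, hl2⟩ := key t ht
  have hker : ∀ x : F × F, v 0 * x.1 + v 1 * x.2 = 0 → v 2 * x.1 + v 3 * x.2 = 0 → x = 0 := by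
    intro x h1 h2
    have h3 : dett v * x.1 = 0 := by simp only [dett]; linear_combination v 3 * h1 - v 1 * h2
    have h4 : dett v * x.2 = 0 := by simp only [dett]; linear_combination v 0 * h2 - v 2 * h1
    ext
    · simpa [hd] using h3
    · simpa [hd] using h4
  have hdet : k.1 * l.2 - k.2 * l.1 ≠ 0 := by
    intro h0
    have hlin : ∃ r ≠ 0, l.1 = r * k.1 ∧ l.2 = r * k.2 := by
      by_cases h1 : k.1 = 0
      · have h2 : k.2 ≠ 0 := fun h2 => hk (Prod.ext h1 h2)
        have h3 : l.1 = 0 := by simpa [h1, h2] using h0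
        have h4 : l.2 ≠ 0 := fun h4 => hl (Prod.ext h3 h4)
        exact ⟨l.2 / k.2, div_ne_zero h4 h2, by simp [h1, h3], by field_simp⟩
      · have h3 : l.2 = l.1 / k.1 * k.2 := by field_simp; linear_combination h0
        have h4 : l.1 ≠ 0 := fun h4 => hl (Prod.ext h4 (by simp [h3, h4]))
        exact ⟨l.1 / k.1, div_ne_zero h4 h1, by field_simp, h3⟩
    obtain ⟨r, hr, h1, h2⟩ := hlin
    rw [h1, h2] at hl1 hl2
    have hst' := sub_ne_zero.2 hst
    apply hk
    apply hker
    · apply mul_left_cancel₀ hr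
      apply mul_left_cancel₀ hst'
      linear_combination s * hl1 - r * t * hk1
    · apply mul_left_cancel₀ hr
      apply mul_left_cancel₀ hst'
      linear_combination s * hl2 - r * t * hk2
  refine ⟨k, (l.1 / (k.1 * l.2 - k.2 * l.1), l.2 / (k.1 * l.2 - k.2 * l.1)), ?_, ?_⟩
  · field_simp
  · generalize (k.1 * l.2 - k.2 * l.1) = δ at hdet
    have hdet' : σ δ ≠ 0 := by simpa using hdet
    simp only [congAct, sesq, Matrix.cons_val, map_add, map_mul, map_div₀, h.conj_conj]
    refine ⟨?_, ?_, ?_, ?_⟩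
    · linear_combination σ k.1 * hk1 + σ k.2 * hk2
    · field_simp
      linear_combination σ k.1 * hl1 + σ k.2 * hl2
    · field_simp
      linear_combination σ l.1 * hk1 + σ l.2 * hk2
    · field_simp
      linear_combination σ l.1 * hl1 + σ l.2 * hl2

end IsQuadExt

namespace IsTraceParam

variable {F : Type*} [Field F] [Fintype F] {c γ ε : F} (hc : IsTraceParam c γ ε)
  {σ : F →+* F} {m : ℕ} (h : IsQuadExt σ m)
include hc h

theorem exists_congAct_of_isGeneric (hγε : σ γ = ε * γ) {v : Fin 4 → F}
    (hv : IsGeneric σ m γ v) :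
    ∃ k l : F × F, k.1 * l.2 - k.2 * l.1 = 1 ∧ ∃ s t : F,
      s * σ s * (c * σ c) = ε ∧ t * σ t * ε = c * σ c ∧ s * σ t * c = ε * σ c ∧
      congAct σ k l v 0 = -s * σ (congAct σ k l v 0) ∧
      congAct σ k l v 1 = -t * σ (congAct σ k l v 2) ∧
      congAct σ k l v 2 = -s * σ (congAct σ k l v 1) ∧
      congAct σ k l v 3 = -t * σ (congAct σ k l v 3) := by
  obtain ⟨hd, hH⟩ := hv
  have h0 := hc.ne_zero
  have h0' : σ c ≠ 0 := by simpa using h0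
  have hdm : dett v ^ m ≠ 0 := pow_ne_zero _ hd
  have hdm' : σ (dett v ^ m) ≠ 0 := by simpa using hdm
  have hdε : dett v ^ m * σ (dett v ^ m) = ε := by
    rw [← (h.conj_eq_iff hc.trace_ne_zero hc.sign hγε hd).1 (by rw [← hH, h.conj_herm]),
      h.apply]
    ring
  have hfac : ∀ t, dett v + t * herm σ v + t ^ 2 * σ (dett v) =
      dett v * ((1 + t * dett v ^ m * c) * (1 + t * dett v ^ m * c⁻¹)) := by
    intro t
    rw [hH, hc.eq, h.apply]
    field_simp
    ring
  obtain ⟨k, l, hkl, h1, h2, h3, h4⟩ := h.exists_congAct_eigen (v := v)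
    (s := -(dett v ^ m * c)⁻¹) (t := -(c / dett v ^ m)) hd (by
      intro h5
      apply hc.sq_ne_one
      field_simp at h5
      linear_combination h5) (by
      rw [hfac]; field_simp; ring) (by
      rw [hfac]; field_simp; ring)
  refine ⟨k, l, hkl, _, _, ?_, ?_, ?_, h1, h2, h3, h4⟩
  · simp only [map_neg, map_inv₀, map_mul]
    generalize dett v ^ m = δ at *
    field_simp
    linear_combination (-ε) * hdε - hc.sign
  · simp only [map_neg, map_div₀]
    generalize dett v ^ m = δ at *
    field_simp
    linear_combination - hdε
  · simp only [map_neg, map_div₀]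
    generalize dett v ^ m = δ at *
    field_simp
    linear_combination (-ε) * hdε - hc.sign

theorem exists_congAct_of_circle (hS : c * σ c = ε) {v : Fin 4 → F}
    (hv : IsGeneric σ m γ v) :
    ∃ k l : F × F, k.1 * l.2 - k.2 * l.1 = 1 ∧ ∃ a b : F, congAct σ k l v = ![a, 0, 0, b] := by
  obtain ⟨k, l, hkl, s, t, -, -, hst, -, h1, h2, -⟩ :=
    hc.exists_congAct_of_isGeneric h (hc.conj_trace_of_circle hS) hv
  have h0 := hc.ne_zero
  have hst' : s * σ t * c ^ 2 = 1 := by linear_combination c * hst + ε * hS + hc.sign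
  generalize hw : congAct σ k l v = w at *
  have h2' : w 2 = 0 := by
    have h3 : w 2 = s * σ t * w 2 := by
      nth_rw 1 [h2]
      rw [h1]
      simp only [map_mul, map_neg, h.conj_conj]
      ring
    have h4 : (c ^ 2 - 1) * w 2 = 0 := by linear_combination c ^ 2 * h3 + w 2 * hst'
    exact (mul_eq_zero.1 h4).resolve_left (sub_ne_zero.2 hc.sq_ne_one)
  refine ⟨k, l, hkl, w 0, w 3, ?_⟩
  rw [hw]
  ext i
  fin_cases i <;> simp [h1, h2']

theorem exists_congAct_of_line (hE : σ c = ε * c) {v : Fin 4 → F}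
    (hv : IsGeneric σ m γ v) :
    ∃ k l : F × F, k.1 * l.2 - k.2 * l.1 = 1 ∧ ∃ a b : F, congAct σ k l v = ![0, a, b, 0] := by
  obtain ⟨k, l, hkl, s, t, hs, ht, -, h0, -, -, h3⟩ :=
    hc.exists_congAct_of_isGeneric h (hc.conj_trace_of_line hE) hv
  have hε : ε ≠ 0 := hc.sign_ne_zero
  have hs' : s * σ s * c ^ 2 = 1 := by
    apply mul_left_cancel₀ hε
    rw [hE] at hs
    linear_combination hs
  have ht' : t * σ t = c ^ 2 := by
    apply mul_left_cancel₀ hε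
    rw [hE] at ht
    linear_combination ht
  generalize hw : congAct σ k l v = w at *
  have key : ∀ r x : F, x = -r * σ x → r * σ r ≠ 1 → x = 0 := by
    intro r x hx hr
    have h4 : x = r * σ r * x := by
      nth_rw 1 [hx, hx]
      simp only [map_mul, map_neg, h.conj_conj]
      ring
    have h5 : (r * σ r - 1) * x = 0 := by linear_combination -h4
    exact (mul_eq_zero.1 h5).resolve_left (sub_ne_zero.2 hr)
  have h0' : w 0 = 0 := key s _ h0 fun h4 => hc.sq_ne_one (by rw [h4] at hs'; simpa using hs')
  have h3' : w 3 = 0 := key t _ h3 fun h4 => hc.sq_ne_one (by rw [← ht', h4])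
  refine ⟨k, l, hkl, w 1, w 2, ?_⟩
  rw [hw]
  ext i
  fin_cases i <;> simp [h0', h3']

end IsTraceParam

/-- The coordinate change turning `polar` into the dot product. -/
def polarDual {F : Type*} [Field F] (a : Fin 4 → F) : Fin 4 → F := ![a 3, -a 2, -a 1, a 0]

theorem polarDual_polarDual {F : Type*} [Field F] (a : Fin 4 → F) :
    polarDual (polarDual a) = a := by
  ext i
  fin_cases i <;> simp [polarDual]

theorem polar_polarDual {F : Type*} [Field F] (a v : Fin 4 → F) :
    polar (polarDual a) v = a ⬝ᵥ v := by
  simp [polar, polarDual, dotProduct, Fin.sum_univ_four]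
  ring

theorem polarDual_eq_zero_iff {F : Type*} [Field F] (a : Fin 4 → F) :
    polarDual a = 0 ↔ a = 0 := by
  rw [fin_four_eq_zero_iff, fin_four_eq_zero_iff]
  simp [polarDual]
  tauto

theorem dett_smul {F : Type*} [Field F] (t : F) (v : Fin 4 → F) :
    dett (t • v) = t ^ 2 * dett v := by
  simp [dett]; ring

theorem herm_smul {F : Type*} [Field F] (σ : F →+* F) (t : F) (v : Fin 4 → F) :
    herm σ (t • v) = t * σ t * herm σ v := by
  simp [herm]; ring

theorem herm_smul_eq_iff {F : Type*} [Field F] {σ : F →+* F} {m : ℕ}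
    (hσ : ∀ x, σ x = x ^ (2 * m + 1)) {γ t : F} {v : Fin 4 → F} (ht : t ≠ 0) :
    herm σ (t • v) = γ * dett (t • v) ^ (m + 1) ↔ herm σ v = γ * dett v ^ (m + 1) := by
  have h1 : γ * (t ^ 2 * dett v) ^ (m + 1) = t * σ t * (γ * dett v ^ (m + 1)) := by
    rw [mul_pow, ← pow_mul, hσ]; ring
  rw [herm_smul, dett_smul, h1]
  exact mul_right_inj' (mul_ne_zero ht (by simpa using ht))

/-- The integer valued function supported on the cone over the zeros of
`herm σ - γ * dett ^ (m + 1)`, with the values `α` at the origin and `lam` at the singular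
points. -/
def weight {F : Type*} [Field F] [DecidableEq F] (σ : F →+* F) (m : ℕ) (γ : F) (α lam : ℤ)
    (v : Fin 4 → F) : ℤ :=
  (if v = 0 then α else 0) + (if IsVertex σ v then lam else 0) +
    (if IsGeneric σ m γ v then 1 else 0)

section weight

variable {F : Type*} [Field F] [DecidableEq F] {σ : F →+* F} {m : ℕ} {γ : F} {α lam : ℤ}
  {v w : Fin 4 → F}

theorem weight_zero : weight σ m γ α lam 0 = α := by
  have h1 : ¬ IsVertex σ (0 : Fin 4 → F) := fun h => h.1 rfl
  have h2 : ¬ IsGeneric σ m γ 0 := fun h => h.1 (by simp [dett])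
  simp [weight, h1, h2]

theorem weight_of_isVertex (hv : IsVertex σ v) : weight σ m γ α lam v = lam := by
  have h2 : ¬ IsGeneric σ m γ v := fun h => h.1 hv.2.1
  simp [weight, hv, hv.1, h2]

theorem weight_of_isGeneric (hv : IsGeneric σ m γ v) : weight σ m γ α lam v = 1 := by
  have h1 : v ≠ 0 := by rintro rfl; exact hv.1 (by simp [dett])
  have h2 : ¬ IsVertex σ v := fun h => hv.1 h.2.1
  simp [weight, hv, h1, h2]

theorem weight_of_not (h0 : v ≠ 0) (h1 : ¬ IsVertex σ v) (h2 : ¬ IsGeneric σ m γ v) :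
    weight σ m γ α lam v = 0 := by
  simp [weight, h0, h1, h2]

theorem weight_congr (h0 : v = 0 ↔ w = 0) (h1 : IsVertex σ v ↔ IsVertex σ w)
    (h2 : IsGeneric σ m γ v ↔ IsGeneric σ m γ w) :
    weight σ m γ α lam v = weight σ m γ α lam w := by
  simp only [weight]
  rw [if_congr h0 rfl rfl, if_congr h1 rfl rfl, if_congr h2 rfl rfl]

end weight

theorem weight_polarDual {F : Type*} [Field F] [DecidableEq F] (σ : F →+* F) (m : ℕ) (γ : F)
    (α lam : ℤ) (v : Fin 4 → F) :
    weight σ m γ α lam (polarDual v) = weight σ m γ α lam v := by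
  have h1 : dett (polarDual v) = dett v := by simp [polarDual, dett]; ring
  have h2 : herm σ (polarDual v) = herm σ v := by simp [polarDual, herm]; ring
  apply weight_congr <;> simp only [IsVertex, IsGeneric, Ne, polarDual_eq_zero_iff, h1, h2]

theorem weight_sq {F : Type*} [Field F] [DecidableEq F] (σ : F →+* F) (m : ℕ) (γ : F) (α lam : ℤ)
    (v : Fin 4 → F) : weight σ m γ α lam v ^ 2 = weight σ m γ (α ^ 2) (lam ^ 2) v := by
  have h1 : v = 0 → ¬ IsGeneric σ m γ v := by rintro rfl h; exact h.1 (by simp [dett])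
  have h2 : IsVertex σ v → ¬ IsGeneric σ m γ v := fun h h' => h'.1 h.2.1
  have h3 : IsVertex σ v → v ≠ 0 := fun h => h.1
  unfold weight
  split_ifs <;> simp_all

theorem sum_filter_weight {F : Type*} [Field F] [Fintype F] [DecidableEq F] (σ : F →+* F) (m : ℕ)
    (γ : F) (α lam : ℤ) (W : (Fin 4 → F) → Prop) [DecidablePred W] (hW : W 0) :
    ∑ v with W v, weight σ m γ α lam v =
      α + lam * #{v | W v ∧ IsVertex σ v} + #{v | W v ∧ IsGeneric σ m γ v} := by
  simp only [weight, sum_add_distrib]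
  congr 1
  · congr 1
    · rw [sum_ite_eq' _ _ _, if_pos ((mem_filter_univ _).2 hW)]
    · rw [← sum_filter, filter_filter, sum_const, nsmul_eq_mul, mul_comm]
  · rw [← sum_filter, filter_filter, sum_const, nsmul_eq_mul, mul_one]

theorem sum_weight {F : Type*} [Field F] [Fintype F] [DecidableEq F] (σ : F →+* F) (m : ℕ)
    (γ : F) (α lam : ℤ) : ∑ v, weight σ m γ α lam v =
      α + lam * #{v | IsVertex σ v} + #{v | IsGeneric σ m γ v} := by
  have h1 := sum_filter_weight σ m γ α lam (fun _ => True) trivial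
  simpa only [filter_true, true_and] using h1

namespace IsQuadExt

variable {F : Type*} [Field F] [Fintype F] [DecidableEq F] {σ : F →+* F} {m : ℕ}
  (h : IsQuadExt σ m)

include h

theorem weight_smul (γ : F) (α lam : ℤ) {t : F} (v : Fin 4 → F) (ht : t ≠ 0) :
    weight σ m γ α lam (t • v) = weight σ m γ α lam v := by
  apply weight_congr
  · simp [ht]
  · simp [IsVertex, dett_smul, herm_smul, ht]
  · rw [IsGeneric, IsGeneric, herm_smul_eq_iff h.apply ht, dett_smul]
    simp [ht]

theorem weight_congAct (γ : F) (α lam : ℤ) {k l : F × F} (hkl : k.1 * l.2 - k.2 * l.1 = 1)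
    (v : Fin 4 → F) : weight σ m γ α lam (congAct σ k l v) = weight σ m γ α lam v := by
  exact weight_congr (congAct_eq_zero_iff σ hkl v) (h.isVertex_congAct hkl v)
    (h.isGeneric_congAct hkl γ v)

theorem sum_weight_congAct (γ : F) (α lam : ℤ) {k l : F × F} (hkl : k.1 * l.2 - k.2 * l.1 = 1)
    (P : Fin 4 → F) :
    ∑ v with polar (congAct σ k l P) v = 0, weight σ m γ α lam v =
      ∑ v with polar P v = 0, weight σ m γ α lam v := by
  symm
  refine sum_equiv (congEquiv σ hkl) (fun v => ?_) (fun v _ => ?_)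
  · simp only [mem_filter_univ]
    change _ ↔ polar (congAct σ k l P) (congAct σ k l v) = 0
    rw [polar_congAct, hkl, map_one, one_mul, one_mul]
  · exact (h.weight_congAct γ α lam hkl v).symm

theorem sum_weight_polar_eq {γ γ' : F} {α lam : ℤ}
    (hnorm : #{v | IsGeneric σ m γ' v} = #{v | IsGeneric σ m γ v})
    (htotal : ∑ v, weight σ m γ α lam v = (Fintype.card F : ℤ) ^ 2 * α)
    (hvertex : ∑ v with v 0 = 0, weight σ m γ α lam v =
      Fintype.card F * α + ((Fintype.card F : ℤ) - 1) * Fintype.card F * lam)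
    (hgeneric : ∀ P, IsGeneric σ m γ' P → ∑ v with polar P v = 0, weight σ m γ α lam v =
      Fintype.card F * α + ((Fintype.card F : ℤ) - 1) * Fintype.card F) (P : Fin 4 → F) :
    ∑ v with polar P v = 0, weight σ m γ α lam v = Fintype.card F * α +
      ((Fintype.card F : ℤ) - 1) * Fintype.card F * weight σ m γ' α lam P := by
  have hQ : (Fintype.card F : ℤ) ≠ 0 := by exact_mod_cast Fintype.card_ne_zero
  have hsupp : ∀ P, weight σ m γ' α lam P ≠ 0 →
      ∑ v with polar P v = 0, weight σ m γ α lam v = Fintype.card F * α +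
      ((Fintype.card F : ℤ) - 1) * Fintype.card F * weight σ m γ' α lam P := by
    intro P hP
    by_cases h1 : P = 0
    · have h4 : ∀ v, polar P v = 0 := by intro v; simp [h1, polar]
      simp only [h4, filter_true, htotal]
      rw [h1, weight_zero]
      ring
    by_cases h2 : IsVertex σ P
    · obtain ⟨k, l, hkl, p, hp, h4⟩ := h.exists_congAct_of_isVertex h2
      have h5 : ∀ v : Fin 4 → F, polar ![0, 0, 0, p] v = 0 ↔ v 0 = 0 := by
        intro v; simp [polar, hp]
      rw [← h.sum_weight_congAct γ α lam hkl, h4]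
      simp only [h5]
      rw [hvertex, weight_of_isVertex h2]
    by_cases h3 : IsGeneric σ m γ' P
    · rw [hgeneric P h3, weight_of_isGeneric h3, mul_one]
    · exact absurd (weight_of_not h1 h2 h3) hP
  have key := hyperplane_transform_eq (weight σ m γ α lam)
    (fun a => weight σ m γ' α lam (polarDual a)) (fun t v ht => h.weight_smul γ α lam v ht)
    (c := ((Fintype.card F : ℤ) - 1) * Fintype.card F ^ 2)
    (by rw [Fintype.card_fin]; ring)
    (by simp only [weight_polarDual, weight_sq, sum_weight, hnorm])
    (by
      intro a ha
      simp only [← polar_polarDual]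
      rw [hsupp _ ha, htotal]
      ring) (polarDual P)
  simp only [← polar_polarDual, polarDual_polarDual, htotal] at key
  apply mul_left_cancel₀ hQ
  linear_combination key

end IsQuadExt

namespace IsQuadExt

variable {F : Type*} [Field F] [Fintype F] [DecidableEq F] {σ : F →+* F} {m : ℕ}
  (h : IsQuadExt σ m)
include h

theorem card_isGeneric_elliptic {γ a b ε : F} (ha : a ≠ 0) (hb : b ≠ 0)
    (hγ : σ a * b + a * σ b = γ * (a * b) ^ (m + 1)) (hγ0 : γ ≠ 0) (hγ4 : γ ^ 2 ≠ 4)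
    (hε : ε * ε = 1) (hγε : σ γ = ε * γ) :
    #{v : Fin 4 → F | a * v 3 = b * v 0 ∧ IsGeneric σ m γ v} =
      (Fintype.card F - 1) + (Fintype.card F - 1) ^ 2 * (m + 1) := by
  have h1 := h.card_elliptic_cover ha hb hγ hγ0 hε hγε
  rw [card_filter_split (fun p : F × (Fin 4 → F) => (p.2 0 / a) ^ (2 : ℕ) = p.1 ^ (2 : ℕ)),
    h.card_elliptic_cover_diag ha, h.card_elliptic_cover_off_diag ha hb hγ hγ4] at h1
  nlinarith

end IsQuadExt

namespace IsTraceParam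

variable {F : Type*} [Field F] {c γ ε : F} (hc : IsTraceParam c γ ε)

include hc in
theorem smul {s : F} (hs : s * s = 1) : IsTraceParam (s * c) (s * γ) ε where
  ne_zero := mul_ne_zero (by rintro rfl; simp at hs) hc.ne_zero
  pow_four_ne := by
    rw [mul_pow, show s ^ 4 = (s * s) ^ 2 by ring, hs, one_pow, one_mul]
    exact hc.pow_four_ne
  eq := by rw [hc.eq, mul_inv, inv_eq_of_mul_eq_one_left hs, mul_add]
  sign := hc.sign

variable [Fintype F] [DecidableEq F] {σ : F →+* F} {m : ℕ} (h : IsQuadExt σ m)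
include hc h

theorem card_isGeneric_of_circle (hS : c * σ c = ε) :
    #{v : Fin 4 → F | IsGeneric σ m γ v} =
      4 * m * (m + 1) * (2 * m + 1) ^ 2 * (m * (4 * m ^ 2 + 4 * m + 2)) := by
  rw [h.card_isGeneric, hc.card_affine_of_circle h hS, hc.card_infinity_of_circle h hS,
    h.card_sub_one, h.card, add_zero]

theorem card_isGeneric_of_line (hE : σ c = ε * c) :
    #{v : Fin 4 → F | IsGeneric σ m γ v} =
      4 * m * (m + 1) * (2 * m + 1) ^ 2 * (4 * m * (m + 1) ^ 2 + (2 * m + 2)) := by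
  rw [h.card_isGeneric, hc.card_affine_of_line h hE, hc.card_infinity_of_line h hE,
    h.card_sub_one, h.card]

theorem sum_weight_polar_of_circle (hS : c * σ c = ε) (P : Fin 4 → F) :
    ∑ v with polar P v = 0, weight σ m γ (4 * m ^ 2 * (m + 1)) (-m) v =
      Fintype.card F * (4 * m ^ 2 * (m + 1)) + ((Fintype.card F : ℤ) - 1) * Fintype.card F *
        weight σ m ((-1) ^ m * γ) (4 * m ^ 2 * (m + 1)) (-m) P := by
  have hs : ((-1) ^ m * (-1) ^ m : F) = 1 := by rw [← mul_pow]; simp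
  have hc' := hc.smul hs
  have hS' : (-1) ^ m * c * σ ((-1) ^ m * c) = ε := by
    simp only [map_mul, map_pow, map_neg, map_one]
    linear_combination c * σ c * hs + hS
  refine h.sum_weight_polar_eq ?_ ?_ ?_ ?_ P
  · rw [hc.card_isGeneric_of_circle h hS, hc'.card_isGeneric_of_circle h hS']
  · rw [sum_weight, hc.card_isGeneric_of_circle h hS, h.card_isVertex, h.card_sub_one, h.card]
    push_cast
    ring
  · rw [sum_filter_weight _ _ _ _ _ _ (by simp), IsQuadExt.card_isVertex_infinity, h.card_isGeneric_infinity,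
      hc.card_infinity_of_circle h hS, h.card_sub_one, h.card]
    push_cast
    ring
  · intro P hP
    obtain ⟨k, l, hkl, a, b, hab⟩ := hc'.exists_congAct_of_circle h hS' hP
    have h1 := (h.isGeneric_congAct hkl _ P).2 hP
    rw [← h.sum_weight_congAct _ _ _ hkl, hab]
    rw [hab] at h1
    obtain ⟨h2, h3⟩ := h1
    simp only [dett, herm, Matrix.cons_val, map_zero, mul_zero, sub_zero] at h2 h3
    obtain ⟨ha, hb⟩ := mul_ne_zero_iff.1 h2
    have hγ : σ a * (-b) + a * σ (-b) = γ * (a * -b) ^ (m + 1) := by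
      rw [mul_neg, mul_neg, neg_pow (a * b), map_neg]
      linear_combination (-1) * h3
    have hpl : ∀ v : Fin 4 → F, polar ![a, 0, 0, b] v = 0 ↔ a * v 3 = -b * v 0 := by
      intro v
      simp only [polar, Matrix.cons_val]
      constructor <;> intro h4 <;> linear_combination h4
    simp only [hpl]
    rw [sum_filter_weight _ _ _ _ _ _ (by simp),
      h.card_isVertex_elliptic ha (neg_ne_zero.2 hb) hγ hc.trace_sq_ne_four,
      h.card_isGeneric_elliptic ha (neg_ne_zero.2 hb) hγ hc.trace_ne_zero hc.trace_sq_ne_four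
        hc.sign (hc.conj_trace_of_circle hS), h.card_sub_one, h.card]
    push_cast
    ring

theorem sum_weight_polar_of_line (hE : σ c = ε * c) (P : Fin 4 → F) :
    ∑ v with polar P v = 0, weight σ m γ ((m + 1) * (4 * m ^ 2 + 4 * m + 2)) (m + 1) v =
      Fintype.card F * ((m + 1) * (4 * m ^ 2 + 4 * m + 2)) +
        ((Fintype.card F : ℤ) - 1) * Fintype.card F *
        weight σ m ((-1) ^ (m + 1) * γ) ((m + 1) * (4 * m ^ 2 + 4 * m + 2)) (m + 1) P := by
  have hs : ((-1) ^ (m + 1) * (-1) ^ (m + 1) : F) = 1 := by rw [← mul_pow]; simp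
  have hc' := hc.smul hs
  have hE' : σ ((-1) ^ (m + 1) * c) = ε * ((-1) ^ (m + 1) * c) := by
    simp only [map_mul, map_pow, map_neg, map_one]
    rw [hE]
    ring
  refine h.sum_weight_polar_eq ?_ ?_ ?_ ?_ P
  · rw [hc.card_isGeneric_of_line h hE, hc'.card_isGeneric_of_line h hE']
  · rw [sum_weight, hc.card_isGeneric_of_line h hE, h.card_isVertex, h.card_sub_one, h.card]
    push_cast
    ring
  · rw [sum_filter_weight _ _ _ _ _ _ (by simp), IsQuadExt.card_isVertex_infinity, h.card_isGeneric_infinity,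
      hc.card_infinity_of_line h hE, h.card_sub_one, h.card]
    push_cast
    ring
  · intro P hP
    obtain ⟨k, l, hkl, a, b, hab⟩ := hc'.exists_congAct_of_line h hE' hP
    have h1 := (h.isGeneric_congAct hkl _ P).2 hP
    rw [← h.sum_weight_congAct _ _ _ hkl, hab]
    rw [hab] at h1
    obtain ⟨h2, h3⟩ := h1
    simp only [dett, herm, Matrix.cons_val, map_zero, mul_zero, zero_sub, zero_add] at h2 h3
    obtain ⟨ha, hb⟩ := mul_ne_zero_iff.1 (neg_ne_zero.1 h2)
    have hγ : -(a * σ a + b * σ b) = γ * (a * b) ^ (m + 1) := by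
      rw [neg_pow (a * b)] at h3
      linear_combination h3 + γ * (a * b) ^ (m + 1) * hs
    have hne : a * σ a ≠ b * σ b := by
      intro h4
      have h5 : ((a * b) ^ (m + 1)) ^ 2 = (a * σ a) * (b * σ b) := by
        rw [h.apply, h.apply]; ring
      have h6 : a * σ a ≠ 0 := mul_ne_zero ha (by simpa using ha)
      apply hc.trace_sq_ne_four
      have h7 : (a * σ a) ^ 2 * (γ ^ 2 - 4) = 0 := by
        rw [← h4] at hγ h5
        linear_combination (a * σ a + a * σ a - γ * (a * b) ^ (m + 1)) * hγ - γ ^ 2 * h5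
      exact sub_eq_zero.1 ((mul_eq_zero.1 h7).resolve_left (pow_ne_zero _ h6))
    have hpl : ∀ v : Fin 4 → F, polar ![0, a, b, 0] v = 0 ↔ a * v 2 + b * v 1 = 0 := by
      intro v
      simp only [polar, Matrix.cons_val]
      constructor <;> intro h4 <;> linear_combination -h4
    simp only [hpl]
    rw [sum_filter_weight _ _ _ _ _ _ (by simp), h.card_isVertex_hyperbolic hne,
      h.card_isGeneric_hyperbolic ha hb hne hγ, hc.card_affine_of_line h hE, h.card_sub_one, h.card]
    push_cast
    ring

end IsTraceParam

theorem weight_add_weight {F : Type*} [Field F] [DecidableEq F] (σ : F →+* F) (m : ℕ) {γ δ : F}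
    (hγδ : γ ≠ δ) {α β lam mu : ℤ} (hl : lam + mu = 1) (v : Fin 4 → F) :
    weight σ m γ α lam v + weight σ m δ β mu v = (if v = 0 then α + β else 0) +
      if v ≠ 0 ∧ (herm σ v = γ * dett v ^ (m + 1) ∨ herm σ v = δ * dett v ^ (m + 1))
        then 1 else 0 := by
  by_cases h0 : v = 0
  · rw [h0, weight_zero, weight_zero]
    simp
  by_cases h1 : dett v = 0
  · by_cases h2 : herm σ v = 0
    · rw [weight_of_isVertex ⟨h0, h1, h2⟩, weight_of_isVertex ⟨h0, h1, h2⟩, hl]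
      simp [h0, h1, h2]
    · rw [weight_of_not h0 (fun h => h2 h.2.2) (fun h => h.1 h1),
        weight_of_not h0 (fun h => h2 h.2.2) (fun h => h.1 h1)]
      simp [h0, h1, h2]
  · have h3 : ¬ IsVertex σ v := fun h => h1 h.2.1
    by_cases h4 : herm σ v = γ * dett v ^ (m + 1)
    · have h5 : herm σ v ≠ δ * dett v ^ (m + 1) := fun h5 =>
        hγδ (mul_right_cancel₀ (pow_ne_zero _ h1) (h4.symm.trans h5))
      rw [weight_of_isGeneric ⟨h1, h4⟩, weight_of_not h0 h3 (fun h => h5 h.2)]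
      simp [h0, h4]
    · rw [weight_of_not h0 h3 (fun h => h4 h.2)]
      by_cases h5 : herm σ v = δ * dett v ^ (m + 1)
      · rw [weight_of_isGeneric ⟨h1, h5⟩]
        simp [h0, h5]
      · rw [weight_of_not h0 h3 (fun h => h5 h.2)]
        simp [h0, h4, h5]

theorem card_union_filter {F : Type*} [Field F] [Fintype F] [DecidableEq F] (σ : F →+* F) (m : ℕ)
    {γ δ : F} (hγδ : γ ≠ δ) {α β lam mu : ℤ} (hl : lam + mu = 1) (W : (Fin 4 → F) → Prop)
    [DecidablePred W] (hW : W 0) :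
    (#{v | W v ∧ v ≠ 0 ∧
      (herm σ v = γ * dett v ^ (m + 1) ∨ herm σ v = δ * dett v ^ (m + 1))} : ℤ) =
      ∑ v with W v, weight σ m γ α lam v + ∑ v with W v, weight σ m δ β mu v - (α + β) := by
  rw [← sum_add_distrib]
  simp only [weight_add_weight σ m hγδ hl]
  rw [sum_add_distrib, sum_ite_eq' _ _ _, if_pos ((mem_filter_univ _).2 hW), ← sum_filter,
    filter_filter, sum_const, nsmul_eq_mul, mul_one]
  ring

namespace IsTraceParam

variable {F : Type*} [Field F] [Fintype F] {c d γ δ ε η : F} (hc : IsTraceParam c γ ε)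
  (hd : IsTraceParam d δ η) {σ : F →+* F} {m : ℕ} (h : IsQuadExt σ m)
include hc hd

omit [Fintype F] in
theorem sq_trace_ne (hS : c * σ c = ε) (hE : σ d = η * d) : γ ^ 2 ≠ δ ^ 2 := by
  intro h0
  have h1 := hc.mul_eq
  have h2 := hd.mul_eq
  have hc0 := hc.ne_zero
  have hd0 := hd.ne_zero
  have h3 : (c ^ 2 - d ^ 2) * (c ^ 2 * d ^ 2 - 1) = 0 := by
    have h4 : γ ^ 2 * (c ^ 2 * d ^ 2) = (c ^ 2 + 1) ^ 2 * d ^ 2 := by rw [← h1]; ring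
    have h5 : δ ^ 2 * (c ^ 2 * d ^ 2) = (d ^ 2 + 1) ^ 2 * c ^ 2 := by rw [← h2]; ring
    linear_combination c ^ 2 * d ^ 2 * h0 - h4 + h5
  have hd2 : σ (d ^ 2) = d ^ 2 := by
    rw [map_pow, hE]
    linear_combination d ^ 2 * hd.sign
  have hc2 : σ (c ^ 2) = c ^ 2 := by
    rcases mul_eq_zero.1 h3 with h4 | h4
    · rw [sub_eq_zero.1 h4, hd2]
    · rw [eq_inv_of_mul_eq_one_left (sub_eq_zero.1 h4), map_inv₀, hd2]
  apply hc.pow_four_ne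
  calc c ^ 4 = c ^ 2 * σ (c ^ 2) := by rw [hc2]; ring
    _ = (c * σ c) ^ 2 := by rw [map_pow]; ring
    _ = 1 := by rw [hS, sq, hc.sign]

include h
variable [DecidableEq F]

theorem card_union_polar (hS : c * σ c = ε) (hE : σ d = η * d) {P : Fin 4 → F} (hP : P ≠ 0) :
    #{v | polar P v = 0 ∧ v ≠ 0 ∧
      (herm σ v = γ * dett v ^ (m + 1) ∨ herm σ v = δ * dett v ^ (m + 1))} =
      (Fintype.card F - 1) * ((2 * m + 1) ^ 3 + 1) ∨
    #{v | polar P v = 0 ∧ v ≠ 0 ∧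
      (herm σ v = γ * dett v ^ (m + 1) ∨ herm σ v = δ * dett v ^ (m + 1))} =
      (Fintype.card F - 1) * ((2 * m + 1) ^ 3 + (2 * m + 1) ^ 2 + 1) := by
  have hsq := hc.sq_trace_ne hd hS hE
  have hne : γ ≠ δ := fun h1 => hsq (by rw [h1])
  have hne' : (-1) ^ m * γ ≠ (-1) ^ (m + 1) * δ := by
    intro h1
    apply hsq
    have hs : ((-1) ^ m * (-1) ^ m : F) = 1 := by rw [← mul_pow]; simp
    have h2 : γ = -δ := by
      rw [pow_succ] at h1
      linear_combination (-1) ^ m * h1 - (γ + δ) * hs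
    rw [h2, neg_sq]
  have key := card_union_filter σ m hne (α := 4 * m ^ 2 * (m + 1))
    (β := (m + 1) * (4 * m ^ 2 + 4 * m + 2)) (lam := -m) (mu := m + 1) (by ring)
    (fun v => polar P v = 0) (by simp [polar])
  have hval := weight_add_weight σ m hne' (α := 4 * m ^ 2 * (m + 1))
    (β := (m + 1) * (4 * m ^ 2 + 4 * m + 2)) (lam := -m) (mu := m + 1) (by ring) P
  rw [hc.sum_weight_polar_of_circle h hS, hd.sum_weight_polar_of_line h hE] at key
  rw [if_neg hP, zero_add] at hval
  have hQ : (Fintype.card F : ℤ) = (2 * m + 1) ^ 2 := by rw [h.card]; push_cast; ring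
  rw [hQ] at key
  rw [h.card_sub_one]
  split_ifs at hval with h3
  · right
    zify
    linear_combination key + ((2 * m + 1) ^ 2 - 1) * (2 * m + 1) ^ 2 * hval
  · left
    zify
    linear_combination key + ((2 * m + 1) ^ 2 - 1) * (2 * m + 1) ^ 2 * hval

theorem card_union (hS : c * σ c = ε) (hE : σ d = η * d) :
    #{v | v ≠ 0 ∧ (herm σ v = γ * dett v ^ (m + 1) ∨ herm σ v = δ * dett v ^ (m + 1))} =
      (Fintype.card F - 1) * (((2 * m + 1) ^ 2 + 1) * ((2 * m + 1) ^ 3 + 1)) := by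
  have hne : γ ≠ δ := fun h1 => hc.sq_trace_ne hd hS hE (by rw [h1])
  have key := card_union_filter σ m hne (α := 0) (β := 0) (lam := -m) (mu := m + 1) (by ring)
    (fun _ => True) trivial
  simp only [true_and, filter_true] at key
  rw [sum_weight, sum_weight, hc.card_isGeneric_of_circle h hS, hd.card_isGeneric_of_line h hE,
    h.card_isVertex, h.card_sub_one, h.card] at key
  rw [h.card_sub_one]
  zify
  rw [key]
  push_cast
  ring

end IsTraceParam

section Projective

variable {F : Type*} [Field F]

theorem rep_mk_iff (p : (Fin 4 → F) → Prop)
    (hp : ∀ (t : F) v, t ≠ 0 → (p (t • v) ↔ p v)) (v : Fin 4 → F) (hv : v ≠ 0) :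
    p (Projectivization.mk F v hv).rep ↔ p v := by
  obtain ⟨a, ha⟩ := Projectivization.exists_smul_eq_mk_rep F v hv
  rw [← ha]
  exact hp a v a.ne_zero

theorem ncard_mul_card_sub_one [Fintype F] [DecidableEq F] (p : (Fin 4 → F) → Prop)
    [DecidablePred p] (hp : ∀ (t : F) v, t ≠ 0 → (p (t • v) ↔ p v)) (S : Set (PGPoint F))
    (hS : ∀ P, P ∈ S ↔ p P.rep) :
    (Fintype.card F - 1) * S.ncard = #{v | v ≠ 0 ∧ p v} := by
  classical
  have : Fintype (PGPoint F) := Fintype.ofFinite _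
  rw [← Fintype.card_units, mul_comm, Set.ncard_eq_toFinset_card', ← card_univ, ← card_product]
  refine card_bij (fun x _ => (x.2 : F) • x.1.rep) ?_ ?_ ?_
  · rintro ⟨P, u⟩ hx
    simp only [mem_product, Set.mem_toFinset, mem_univ, and_true] at hx
    rw [mem_filter_univ]
    exact ⟨smul_ne_zero u.ne_zero P.rep_nonzero, (hp _ _ u.ne_zero).2 ((hS P).1 hx)⟩
  · rintro ⟨P, u⟩ - ⟨P', u'⟩ - hx
    simp only at hx
    have h1 : P = P' := by
      rw [← P.mk_rep, ← P'.mk_rep, Projectivization.mk_eq_mk_iff']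
      exact ⟨(u : F)⁻¹ * u', by rw [mul_smul, ← hx, inv_smul_smul₀ u.ne_zero]⟩
    subst h1
    rw [Prod.mk.injEq]
    exact ⟨rfl, Units.ext (smul_left_injective F P.rep_nonzero hx)⟩
  · intro v hv
    rw [mem_filter_univ] at hv
    obtain ⟨a, ha⟩ := Projectivization.exists_smul_eq_mk_rep F v hv.1
    refine ⟨(Projectivization.mk F v hv.1, a⁻¹), ?_, ?_⟩
    · simp only [mem_product, Set.mem_toFinset, mem_univ, and_true]
      exact (hS _).2 ((rep_mk_iff p hp v hv.1).2 hv.2)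
    · rw [← ha]
      exact inv_smul_smul a v

theorem exists_dotProduct_of_finrank {W : Submodule F (Fin 4 → F)} (hW : Module.finrank F W = 3) :
    ∃ a : Fin 4 → F, a ≠ 0 ∧ ∀ v, v ∈ W ↔ a ⬝ᵥ v = 0 := by
  have hlt : W < ⊤ := by
    rw [lt_top_iff_ne_top]
    rintro rfl
    simp at hW
  obtain ⟨f, hf, hle⟩ := W.exists_le_ker_of_lt_top hlt
  have hrank : Module.finrank F (LinearMap.ker f) = 3 := by
    have h1 := f.finrank_range_add_finrank_ker
    rw [LinearMap.range_eq_top.2 (LinearMap.surjective hf)] at h1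
    simp at h1
    omega
  have heq : W = LinearMap.ker f := Submodule.eq_of_le_of_finrank_eq hle (hW.trans hrank.symm)
  have hdot : ∀ v, (fun i => f (Pi.single i 1)) ⬝ᵥ v = f v := by
    intro v
    rw [LinearMap.pi_apply_eq_sum_univ f v]
    simp only [dotProduct, smul_eq_mul]
    refine sum_congr rfl fun i _ => ?_
    rw [mul_comm]
    congr 2
    ext j
    rw [Pi.single_apply, if_congr eq_comm rfl rfl]
  refine ⟨fun i => f (Pi.single i 1), ?_, fun v => ?_⟩
  · intro h0
    apply hf
    ext v
    simpa using congrFun h0 v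
  · rw [heq, LinearMap.mem_ker, hdot]

theorem mem_Cgam_iff {q : ℕ} {γ : F} {σ : F →+* F} {m : ℕ} (hq : q = 2 * m + 1)
    (hσ : ∀ x, σ x = x ^ (2 * m + 1)) (P : PGPoint F) :
    P ∈ Cgam q γ ↔ herm σ P.rep = γ * dett P.rep ^ (m + 1) := by
  subst hq
  have hF : ∀ v : Fin 4 → F, Fgam (2 * m + 1) γ v = herm σ v - γ * dett v ^ (m + 1) := by
    intro v
    have h2 : (2 * m + 1 + 1) / 2 = m + 1 := by omega
    simp only [Fgam, herm, dett, hσ, h2]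
    ring
  have hscale : ∀ (t : F) (v : Fin 4 → F), t ≠ 0 →
      (herm σ (t • v) = γ * dett (t • v) ^ (m + 1) ↔ herm σ v = γ * dett v ^ (m + 1)) :=
    fun t v ht => herm_smul_eq_iff hσ ht
  constructor
  · intro hP
    exact sub_eq_zero.1 (hF _ ▸ hP P.rep P.rep_nonzero P.mk_rep.symm)
  · rintro hP v hv rfl
    rw [hF, sub_eq_zero]
    exact (rep_mk_iff (fun v => herm σ v = γ * dett v ^ (m + 1)) hscale v hv).1 hP

end Projective

theorem orderOf_primitive {F : Type*} [Field F] [Fintype F] {ξ : F}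
    (hξ : ∀ x : F, x ≠ 0 → ∃ m : ℕ, x = ξ ^ m) (hcard : Fintype.card F ≠ 2) :
    ξ ≠ 0 ∧ orderOf ξ = Fintype.card F - 1 := by
  classical
  have h0 : ξ ≠ 0 := by
    rintro rfl
    apply hcard
    have h1 : ∀ x : F, x ≠ 0 → x = 1 := by
      intro x hx
      obtain ⟨i, rfl⟩ := hξ x hx
      rcases i with _ | i
      · simp
      · simp at hx
    rw [← card_univ, show (univ : Finset F) = {0, 1} by
      ext x
      by_cases hx : x = 0 <;> simp [hx, h1 x]]
    exact card_pair zero_ne_one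
  refine ⟨h0, ?_⟩
  have h1 := orderOf_eq_card_of_forall_mem_zpowers (g := Units.mk0 ξ h0) (by
    intro x
    obtain ⟨i, hi⟩ := hξ x x.ne_zero
    exact ⟨i, Units.ext (by simp [hi])⟩)
  rw [← orderOf_units, Units.val_mk0, Nat.card_units, Nat.card_eq_fintype_card] at h1
  exact h1

theorem exists_isQuadExt {F : Type*} [Field F] [Fintype F] {p n m : ℕ} (hp : p.Prime)
    (hm : 0 < m) (hq : 2 * m + 1 = p ^ n) (hF : Fintype.card F = (2 * m + 1) ^ 2) :
    ∃ σ : F →+* F, IsQuadExt σ m := by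
  have : Fact p.Prime := ⟨hp⟩
  have : CharP F p := charP_of_card_eq_prime_pow (f := n * 2) (by rw [hF, hq, pow_mul])
  exact ⟨iterateFrobenius F p n, hF, hm, fun x => by rw [iterateFrobenius_def, hq]⟩

namespace IsQuadExt

variable {F : Type*} [Field F] [Fintype F] {σ : F →+* F} {m : ℕ} (h : IsQuadExt σ m)
  {ξ : F} (h0 : ξ ≠ 0) (hord : orderOf ξ = 4 * m * (m + 1))
include h h0 hord

theorem isTraceParam_circle {j : ℕ} (hj1 : 1 ≤ j) (hj2 : j ≤ 2 * m + 1) (hj : j ≠ m + 1) :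
    IsTraceParam (ξ ^ (j * m)) (ξ ^ (j * m) + (ξ ^ (j * m))⁻¹) (ξ ^ (j * m) * σ (ξ ^ (j * m))) := by
  refine ⟨pow_ne_zero _ h0, fun h1 => hj ?_, rfl, ?_⟩
  · rw [← pow_mul, ← orderOf_dvd_iff_pow_eq_one, hord,
      show j * m * 4 = 4 * m * j by ring] at h1
    obtain ⟨r, hr⟩ := Nat.dvd_of_mul_dvd_mul_left (by have := h.pos; positivity) h1
    rcases r with _ | _ | r
    · omega
    · omega
    · nlinarith
  · rw [h.apply, ← pow_mul, ← pow_add, ← pow_add, ← orderOf_dvd_iff_pow_eq_one, hord]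
    exact ⟨j, by ring⟩

theorem isTraceParam_line {k : ℕ} (hk1 : 1 ≤ k) (hk2 : k ≤ 2 * m - 1) (hk : k ≠ m) :
    IsTraceParam (ξ ^ (k * (m + 1))) (ξ ^ (k * (m + 1)) + (ξ ^ (k * (m + 1)))⁻¹)
      ((ξ ^ (k * (m + 1))) ^ (2 * m)) := by
  have hm := h.pos
  refine ⟨pow_ne_zero _ h0, fun h1 => hk ?_, rfl, ?_⟩
  · rw [← pow_mul, ← orderOf_dvd_iff_pow_eq_one, hord,
      show k * (m + 1) * 4 = 4 * (m + 1) * k by ring,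
      show 4 * m * (m + 1) = 4 * (m + 1) * m by ring] at h1
    obtain ⟨r, hr⟩ := Nat.dvd_of_mul_dvd_mul_left (by positivity) h1
    rcases r with _ | _ | r
    · omega
    · omega
    · have : 2 * m ≤ k := by nlinarith
      omega
  · rw [← pow_mul, ← pow_add, ← orderOf_dvd_iff_pow_eq_one, hord]
    exact ⟨k, by ring⟩

end IsQuadExt

namespace IsTraceParam

variable {F : Type*} [Field F] [Fintype F] {c d γ δ ε η : F} (hc : IsTraceParam c γ ε)
  (hd : IsTraceParam d δ η) {σ : F →+* F} {m : ℕ} (h : IsQuadExt σ m)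
include hc hd h

theorem ncard_union (hS : c * σ c = ε) (hE : σ d = η * d) :
    (Cgam (2 * m + 1) γ ∪ Cgam (2 * m + 1) δ).ncard =
      ((2 * m + 1) ^ 2 + 1) * ((2 * m + 1) ^ 3 + 1) := by
  classical
  have hpos : 0 < Fintype.card F - 1 := by
    have := h.pos
    rw [h.card_sub_one]
    positivity
  apply Nat.eq_of_mul_eq_mul_left hpos
  rw [← hc.card_union hd h hS hE]
  refine ncard_mul_card_sub_one _ (fun t v ht => ?_) _ (fun P => ?_)
  · simp only [herm_smul_eq_iff h.apply ht]
  · rw [Set.mem_union, mem_Cgam_iff rfl h.apply, mem_Cgam_iff rfl h.apply]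

theorem ncard_plane_inter_union (hS : c * σ c = ε) (hE : σ d = η * d) {π : Set (PGPoint F)}
    (hπ : IsPlane π) :
    (π ∩ (Cgam (2 * m + 1) γ ∪ Cgam (2 * m + 1) δ)).ncard = (2 * m + 1) ^ 3 + 1 ∨
    (π ∩ (Cgam (2 * m + 1) γ ∪ Cgam (2 * m + 1) δ)).ncard =
      (2 * m + 1) ^ 3 + (2 * m + 1) ^ 2 + 1 := by
  classical
  obtain ⟨W, hW, hπW⟩ := hπ
  obtain ⟨a, ha, haW⟩ := exists_dotProduct_of_finrank hW
  have hpos : 0 < Fintype.card F - 1 := by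
    have := h.pos
    rw [h.card_sub_one]
    positivity
  have key := ncard_mul_card_sub_one (fun v => polar (polarDual a) v = 0 ∧
    (herm σ v = γ * dett v ^ (m + 1) ∨ herm σ v = δ * dett v ^ (m + 1))) (fun t v ht => by
      simp only [herm_smul_eq_iff h.apply ht, polar_polarDual, dotProduct_smul, smul_eq_mul,
        mul_eq_zero, ht, false_or]) (π ∩ (Cgam (2 * m + 1) γ ∪ Cgam (2 * m + 1) δ)) (fun P => by
      rw [Set.mem_inter_iff, Set.mem_union, mem_Cgam_iff rfl h.apply, mem_Cgam_iff rfl h.apply,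
        polar_polarDual, ← haW, hπW]
      rfl)
  simp only [and_left_comm (a := _ ≠ _)] at key
  refine (hc.card_union_polar hd h hS hE (mt (polarDual_eq_zero_iff a).1 ha)).imp ?_ ?_ <;>
  · intro h1
    exact Nat.eq_of_mul_eq_mul_left hpos (key.trans h1)

end IsTraceParam

end QuasiHermitian

/-- Theorem 2.29 (first family): `S_j ∪ E_k` is a quasi-Hermitian surface of
    `PG(3,q²)`: it has `(q²+1)(q³+1)` points and every plane meets it in `q³+1`
    or `q³+q²+1` points. -/
theorem stmt16 {F : Type*} [Field F] [Fintype F] (p n q : ℕ) (hp : p.Prime)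
    (hodd : Odd p) (hn : 0 < n) (hq : q = p ^ n) (hF : Fintype.card F = q ^ 2)
    (ξ : F) (hξ : ∀ x : F, x ≠ 0 → ∃ m : ℕ, x = ξ ^ m)
    (j : ℕ) (hj1 : 1 ≤ j) (hjq : j ≤ q) (hjne : j ≠ (q + 1) / 2)
    (k : ℕ) (hk1 : 1 ≤ k) (hkq : k ≤ q - 2) (hkne : k ≠ (q - 1) / 2) :
    let V : Set (PGPoint F) :=
      Cgam q (ξ ^ (j * (q - 1) / 2) + (ξ ^ (j * (q - 1) / 2))⁻¹) ∪
        Cgam q (ξ ^ (k * (q + 1) / 2) + (ξ ^ (k * (q + 1) / 2))⁻¹)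
    V.ncard = (q ^ 2 + 1) * (q ^ 3 + 1) ∧
      ∀ π : Set (PGPoint F), IsPlane π →
        (π ∩ V).ncard = q ^ 3 + 1 ∨ (π ∩ V).ncard = q ^ 3 + q ^ 2 + 1 := by
  intro V
  obtain ⟨m, rfl⟩ : Odd q := hq ▸ hodd.pow
  have hm : 0 < m := by omega
  obtain ⟨σ, h⟩ := exists_isQuadExt hp hm hq hF
  obtain ⟨h0, hord⟩ := orderOf_primitive hξ (by rw [hF]; nlinarith)
  rw [h.card_sub_one] at hord
  have hj : j * (2 * m + 1 - 1) / 2 = j * m := by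
    rw [Nat.add_sub_cancel, mul_left_comm, Nat.mul_div_cancel_left _ two_pos]
  have hk : k * (2 * m + 1 + 1) / 2 = k * (m + 1) := by
    rw [show k * (2 * m + 1 + 1) = 2 * (k * (m + 1)) by ring, Nat.mul_div_cancel_left _ two_pos]
  have hc := h.isTraceParam_circle h0 hord hj1 hjq (by omega)
  have hd := h.isTraceParam_line h0 hord hk1 (by omega) (by omega : k ≠ m)
  have hE : σ (ξ ^ (k * (m + 1))) = (ξ ^ (k * (m + 1))) ^ (2 * m) * ξ ^ (k * (m + 1)) := by
    rw [h.apply, pow_succ]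
  simp only [V, hj, hk]
  exact ⟨hc.ncard_union hd h rfl hE, fun π hπ => hc.ncard_plane_inter_union hd h rfl hE hπ⟩
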